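/- Let N ≥ 1 and let p and q be probability vectors on [N] = {0,…,N−1} such that H(p) > H(q) and p stochastically dominates q. Then there exists a monotone factor map from the Bernoulli shift ([N]^ℤ, p^ℤ, S) to the Bernoulli shift ([N]^ℤ, q^ℤ, S); that is, a measurable map φ : [N]^ℤ → [N]^ℤ such that p^ℤ ∘ φ^{-1} = q^ℤ, φ(Sx) = S(φ(x)) for p^ℤ-a.e. x, and φ(x)_i ≤ x_i for all i ∈ ℤ for p^ℤ-a.e. x. -/

import Mathlib

open MeasureTheory

/-- The left shift on `ℤ → Fin N`. -/
def shiftMap {N : ℕ} (x : ℤ → Fin N) : ℤ → Fin N := fun i => x (i + 1)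

/-- `μ` is the Bernoulli (product) measure `p^ℤ` on `(Fin N)^ℤ`:
it is a probability measure giving each cylinder set its product mass. -/
def IsBernoulli {N : ℕ} (p : Fin N → ℝ) (μ : Measure (ℤ → Fin N)) : Prop :=
  IsProbabilityMeasure μ ∧
    ∀ (s : Finset ℤ) (f : ℤ → Fin N),
      μ {x | ∀ i ∈ s, x i = f i} = ∏ i ∈ s, ENNReal.ofReal (p (f i))

/-- Shannon entropy of a probability vector (with the convention `0 log 0 = 0`,
which holds automatically since `Real.log 0 = 0`). -/
noncomputable def shannonH {N : ℕ} (p : Fin N → ℝ) : ℝ :=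
  -∑ i, p i * Real.log (p i)

open scoped ENNReal

/-- A nonzero matrix `h` with vanishing row and column sums, supported where the nonnegative matrix
`r` is, can be added to `r` with some nonnegative factor so that an entry vanishes. -/
theorem exists_add_mul_eq_zero {X Y : Type*} [Fintype X] [Fintype Y] (r h : X → Y → ℝ)
    (hr : ∀ x y, 0 ≤ r x y) (hrow : ∀ x, ∑ y, h x y = 0) (hne : ∃ x y, h x y ≠ 0)
    (hsupp : ∀ x y, r x y = 0 → h x y = 0) :
    ∃ τ : ℝ, 0 ≤ τ ∧ (∀ x y, 0 ≤ r x y + τ * h x y) ∧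
      ∃ x y, r x y ≠ 0 ∧ r x y + τ * h x y = 0 := by
  classical
  obtain ⟨x₀, y₀, hxy⟩ := hne
  obtain ⟨y₁, hy₁⟩ : ∃ y, h x₀ y < 0 := by
    by_contra! hall
    exact hxy ((Finset.sum_eq_zero_iff_of_nonneg fun y _ => hall y).1 (hrow x₀) y₀
      (Finset.mem_univ _))
  obtain ⟨z, hz, hmin⟩ := Finset.exists_min_image
    (Finset.univ.filter fun z : X × Y => h z.1 z.2 < 0) (fun z => r z.1 z.2 / -h z.1 z.2)
    ⟨(x₀, y₁), by simpa using hy₁⟩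
  simp only [Finset.mem_filter, Finset.mem_univ, true_and, Prod.forall] at hz hmin
  have hτ : 0 ≤ r z.1 z.2 / -h z.1 z.2 := div_nonneg (hr _ _) (by linarith)
  refine ⟨r z.1 z.2 / -h z.1 z.2, hτ, fun x y => ?_, z.1, z.2,
    fun h0 => hz.ne (hsupp _ _ h0), ?_⟩
  · rcases lt_or_ge (h x y) 0 with hlt | hge
    · have := hmin x y hlt
      rw [le_div_iff₀ (by linarith)] at this
      linarith
    · have := mul_nonneg hτ hge
      linarith [hr x y]
  · have := hz.ne
    field_simp
    ring

/-- A nonnegative matrix can be replaced by one with the same row and column sums, smaller support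
and no larger cost, in which at most as many rows as there are columns have two nonzero entries. -/
theorem exists_sparse_coupling {X Y : Type*} [Fintype X] [Fintype Y] (r c : X → Y → ℝ)
    (hr : ∀ x y, 0 ≤ r x y) :
    ∃ r' : X → Y → ℝ, (∀ x y, 0 ≤ r' x y) ∧ (∀ x, ∑ y, r' x y = ∑ y, r x y) ∧
      (∀ y, ∑ x, r' x y = ∑ x, r x y) ∧ (∀ x y, r x y = 0 → r' x y = 0) ∧
      (∑ x, ∑ y, c x y * r' x y ≤ ∑ x, ∑ y, c x y * r x y) ∧
      {x | ∃ y y', y ≠ y' ∧ r' x y ≠ 0 ∧ r' x y' ≠ 0}.ncard ≤ Fintype.card Y := by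
  classical
  let Feas : (X → Y → ℝ) → Prop := fun r' => (∀ x y, 0 ≤ r' x y) ∧
    (∀ x, ∑ y, r' x y = ∑ y, r x y) ∧
    (∀ y, ∑ x, r' x y = ∑ x, r x y) ∧ (∀ x y, r x y = 0 → r' x y = 0) ∧
    (∑ x, ∑ y, c x y * r' x y ≤ ∑ x, ∑ y, c x y * r x y)
  let supp : (X → Y → ℝ) → Finset (X × Y) := fun r' => Finset.univ.filter fun z => r' z.1 z.2 ≠ 0
  obtain ⟨r', hF, hmin⟩ : ∃ r', Feas r' ∧ ∀ r'', Feas r'' → (supp r').card ≤ (supp r'').card := by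
    have hne : ({n | ∃ r', Feas r' ∧ (supp r').card = n} : Set ℕ).Nonempty :=
      ⟨_, r, ⟨hr, fun _ => rfl, fun _ => rfl, fun _ _ h => h, le_rfl⟩, rfl⟩
    obtain ⟨r', h1, h2⟩ := Nat.sInf_mem hne
    exact ⟨r', h1, fun r'' h => h2 ▸ Nat.sInf_le ⟨r'', h, rfl⟩⟩
  refine ⟨r', hF.1, hF.2.1, hF.2.2.1, hF.2.2.2.1, hF.2.2.2.2, ?_⟩
  by_contra! hcard
  set P : Set X := {x | ∃ y y', y ≠ y' ∧ r' x y ≠ 0 ∧ r' x y' ≠ 0} with hP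
  have hex : ∀ x : P, ∃ y y', y ≠ y' ∧ r' x y ≠ 0 ∧ r' x y' ≠ 0 := fun x => x.2
  choose u v huv hu hv using hex
  let d : P → Y → ℝ := fun x => Pi.single (u x) 1 - Pi.single (v x) 1
  have hdep : ¬ LinearIndependent ℝ d := by
    intro hli
    have := hli.fintype_card_le_finrank
    rw [Module.finrank_fintype_fun_eq_card] at this
    rw [← Nat.card_coe_set_eq, Nat.card_eq_fintype_card] at hcard
    omega
  rw [Fintype.not_linearIndependent_iff] at hdep
  obtain ⟨g, hg, x₀, hgx₀⟩ := hdep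
  let h₀ : X → Y → ℝ := fun x y => if h : x ∈ P then g ⟨x, h⟩ * d ⟨x, h⟩ y else 0
  have hrow : ∀ x, ∑ y, h₀ x y = 0 := by
    intro x
    by_cases h : x ∈ P
    · simp [h₀, h, d, ← Finset.mul_sum]
    · simp [h₀, h]
  have hcol : ∀ y, ∑ x, h₀ x y = 0 := by
    intro y
    have := congrFun hg y
    rw [Finset.sum_apply] at this
    rw [← Fintype.sum_of_injective (Subtype.val : P → X) Subtype.val_injective
      (fun x => (g x • d x) y) (fun x => h₀ x y) (by simp +contextual [h₀])
      (fun x => by simp [h₀])]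
    simpa using this
  have hne : ∃ x y, h₀ x y ≠ 0 := ⟨x₀, u x₀, by simp [h₀, d, hgx₀, huv]⟩
  have hsupp : ∀ x y, r' x y = 0 → h₀ x y = 0 := by
    intro x y hxy
    by_cases h : x ∈ P
    · have h1 : y ≠ u ⟨x, h⟩ := by rintro rfl; exact hu ⟨x, h⟩ hxy
      have h2 : y ≠ v ⟨x, h⟩ := by rintro rfl; exact hv ⟨x, h⟩ hxy
      simp [h₀, h, d, h1, h2]
    · simp [h₀, h]
  obtain ⟨h, hrow, hcol, hne, hsupp, hcost⟩ : ∃ h : X → Y → ℝ, (∀ x, ∑ y, h x y = 0) ∧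
      (∀ y, ∑ x, h x y = 0) ∧ (∃ x y, h x y ≠ 0) ∧ (∀ x y, r' x y = 0 → h x y = 0) ∧
      ∑ x, ∑ y, c x y * h x y ≤ 0 := by
    rcases le_total (∑ x, ∑ y, c x y * h₀ x y) 0 with h | h
    · exact ⟨h₀, hrow, hcol, hne, hsupp, h⟩
    · refine ⟨fun x y => -h₀ x y, ?_, ?_, ?_, ?_, ?_⟩
      · simpa using hrow
      · simpa using hcol
      · simpa using hne
      · simpa using hsupp
      · simpa using h
  obtain ⟨τ, hτ, hpos, x₁, y₁, hxy₁, hz⟩ := exists_add_mul_eq_zero r' h hF.1 hrow hne hsupp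
  have hF' : Feas fun x y => r' x y + τ * h x y := by
    refine ⟨hpos, fun x => ?_, fun y => ?_, fun x y hxy => ?_, ?_⟩
    · simp [Finset.sum_add_distrib, ← Finset.mul_sum, hrow, hF.2.1]
    · simp [Finset.sum_add_distrib, ← Finset.mul_sum, hcol, hF.2.2.1]
    · have := hF.2.2.2.1 x y hxy
      simp [this, hsupp x y this]
    · have : ∑ x, ∑ y, c x y * (r' x y + τ * h x y)
          = ∑ x, ∑ y, c x y * r' x y + τ * ∑ x, ∑ y, c x y * h x y := by
        simp only [mul_add, Finset.sum_add_distrib, Finset.mul_sum]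
        congr 1
        refine Finset.sum_congr rfl fun x _ => Finset.sum_congr rfl fun y _ => by ring
      rw [this]
      have := mul_nonpos_of_nonneg_of_nonpos hτ hcost
      linarith [hF.2.2.2.2]
  refine absurd (hmin _ hF') (not_le.2 (Finset.card_lt_card ?_))
  rw [Finset.ssubset_iff_of_subset]
  · exact ⟨(x₁, y₁), by simp [supp, hxy₁], by simp [supp, hz]⟩
  · intro z hz'
    simp only [supp, Finset.mem_filter, Finset.mem_univ, true_and] at hz' ⊢
    intro h0
    exact hz' (by simp [h0, hsupp _ _ h0])

/-- A nonnegative matrix can be replaced by one with the same row and column sums, smaller support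
and no larger cost, which is almost the graph of a function `f`: the mass off the graph is bounded
by the mass of the columns outside `S`, the mass of the rows of mass above `θ`, and `S.card * θ`. -/
theorem exists_almost_deterministic_coupling {X Y : Type*} [Fintype X] [Fintype Y] [DecidableEq Y]
    (r c : X → Y → ℝ) (hr : ∀ x y, 0 ≤ r x y) (d : X → Y) (S : Finset Y) {θ : ℝ} (hθ : 0 ≤ θ) :
    ∃ r' : X → Y → ℝ, ∃ f : X → Y, (∀ x y, 0 ≤ r' x y) ∧ (∀ x, ∑ y, r' x y = ∑ y, r x y) ∧
      (∀ y, ∑ x, r' x y = ∑ x, r x y) ∧ (∀ x y, r x y = 0 → r' x y = 0) ∧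
      (∑ x, ∑ y, c x y * r' x y ≤ ∑ x, ∑ y, c x y * r x y) ∧
      (∀ x, f x = d x ∨ r x (f x) ≠ 0) ∧
      ∑ x, ∑ y, (if y = f x then 0 else r' x y) ≤
        ∑ y, (if y ∈ S then 0 else ∑ x, r x y) +
        ∑ x, (if θ < ∑ y, r x y then ∑ y, r x y else 0) + S.card * θ := by
  classical
  obtain ⟨s, hs0, hsrow, hscol, hssupp, hscost, hscard⟩ :=
    exists_sparse_coupling (fun x (y : S) => r x y) (fun x (y : S) => c x y) (fun x y => hr x y)
  have hsplit : ∀ F : Y → ℝ, ∑ y, F y = ∑ y : S, F y + ∑ y, (if y ∈ S then 0 else F y) := by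
    intro F
    rw [Finset.sum_coe_sort S F, ← Finset.sum_filter_add_sum_filter_not Finset.univ (· ∈ S)]
    simp [Finset.sum_ite]
  let r' : X → Y → ℝ := fun x y => if h : y ∈ S then s x ⟨y, h⟩ else r x y
  let f : X → Y := fun x => if h : ∃ y : S, s x y ≠ 0 then h.choose else d x
  have hr'S : ∀ x (y : S), r' x y = s x y := fun x y => by simp [r']
  have hr'0 : ∀ x y, 0 ≤ r' x y := fun x y => by
    by_cases h : y ∈ S <;> simp [r', h, hs0, hr]
  have hrow : ∀ x, ∑ y, r' x y = ∑ y, r x y := by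
    intro x
    rw [hsplit, hsplit (r x)]
    simp only [hr'S, hsrow]
    congr 1
    exact Finset.sum_congr rfl fun y _ => by by_cases h : y ∈ S <;> simp [h, r']
  refine ⟨r', f, hr'0, hrow, fun y => ?_, fun x y hxy => ?_, ?_, fun x => ?_, ?_⟩
  · by_cases h : y ∈ S
    · simpa [r', h] using hscol ⟨y, h⟩
    · simp [r', h]
  · by_cases h : y ∈ S
    · simpa [r', h] using hssupp x ⟨y, h⟩ hxy
    · simpa [r', h] using hxy
  · have : ∀ x, ∑ y, c x y * r' x y = ∑ y : S, c x y * s x y +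
        ∑ y, (if y ∈ S then 0 else c x y * r x y) := by
      intro x
      rw [hsplit]
      simp only [hr'S]
      congr 1
      exact Finset.sum_congr rfl fun y _ => by by_cases h : y ∈ S <;> simp [h, r']
    simp only [this]
    simp only [hsplit (fun y => c _ y * r _ y), Finset.sum_add_distrib]
    linarith
  · by_cases h : ∃ y : S, s x y ≠ 0
    · right
      intro h0
      have h1 : f x = h.choose := by simp only [f, dif_pos h]
      exact h.choose_spec (hssupp x _ (by rw [← h1]; exact h0))
    · left
      simp only [f, dif_neg h]
  · set P : Set X := {x | ∃ y y', y ≠ y' ∧ s x y ≠ 0 ∧ s x y' ≠ 0} with hP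
    have hkey : ∀ x, ∑ y, (if y = f x then 0 else r' x y) ≤
        ∑ y, (if y ∈ S then 0 else r x y) + (if θ < ∑ y, r x y then ∑ y, r x y else 0) +
          (if x ∈ P then θ else 0) := by
      intro x
      rw [hsplit]
      have h1 : ∑ y, (if y ∈ S then 0 else if y = f x then 0 else r' x y) ≤
          ∑ y, (if y ∈ S then 0 else r x y) := by
        refine Finset.sum_le_sum fun y _ => ?_
        by_cases h : y ∈ S
        · simp [h]
        · by_cases h' : y = f x
          · simp [h, ← h', hr]
          · simp [h, h', r']
      have hnn : 0 ≤ ∑ y, r x y := Finset.sum_nonneg fun y _ => hr x y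
      have h2 : ∑ y : S, (if (y : Y) = f x then 0 else r' x y) ≤
          (if θ < ∑ y, r x y then ∑ y, r x y else 0) + (if x ∈ P then θ else 0) := by
        by_cases hx : x ∈ P
        · have h3 : ∑ y : S, (if (y : Y) = f x then 0 else r' x y) ≤ ∑ y, r x y := by
            rw [← hrow, hsplit (r' x)]
            have : 0 ≤ ∑ y, (if y ∈ S then 0 else r' x y) := Finset.sum_nonneg fun y _ => by
              split_ifs <;> simp [hr'0]
            have : ∑ y : S, (if (y : Y) = f x then 0 else r' x y) ≤ ∑ y : S, r' x y :=
              Finset.sum_le_sum fun y _ => by split_ifs <;> simp [hr'0]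
            linarith
          rw [if_pos hx]
          split_ifs with h4
          · linarith
          · linarith [not_lt.1 h4]
        · have h3 : ∑ y : S, (if (y : Y) = f x then 0 else r' x y) = 0 := by
            refine Finset.sum_eq_zero fun y _ => ?_
            by_cases h : ∃ y : S, s x y ≠ 0
            · have h1 : f x = h.choose := by simp only [f, dif_pos h]
              split_ifs with h4
              · rfl
              · rw [hr'S]
                by_contra h5
                refine hx ⟨y, h.choose, fun h6 => h4 ?_, h5, h.choose_spec⟩
                rw [h1, ← h6]
            · push Not at h
              simp [hr'S, h]
          rw [h3, if_neg hx]
          split_ifs <;> simp [hnn]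
      linarith
    refine (Finset.sum_le_sum fun x _ => hkey x).trans ?_
    rw [Finset.sum_add_distrib, Finset.sum_add_distrib, Finset.sum_comm]
    have h1 : ∑ y, ∑ x, (if y ∈ S then 0 else r x y) = ∑ y, (if y ∈ S then 0 else ∑ x, r x y) :=
      Finset.sum_congr rfl fun y _ => by split_ifs <;> simp
    have h2 : ∑ x, (if x ∈ P then θ else 0) ≤ S.card * θ := by
      rw [← Finset.sum_filter, Finset.sum_const, nsmul_eq_mul]
      refine mul_le_mul_of_nonneg_right ?_ hθ
      have : (Finset.univ.filter (· ∈ P)).card = P.ncard := by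
        rw [← Set.ncard_coe_finset]; simp
      rw [this]
      exact_mod_cast hscard.trans (by simp)
    linarith

/-- Chernoff bound: if `a` has negative mean then the mass of the words of length `l` along which
the sum of `a` is nonnegative decays exponentially in `l`. -/
theorem exists_chernoff_bound {ι : Type*} [Fintype ι] (p a : ι → ℝ) (hp0 : ∀ i, 0 ≤ p i)
    (hp1 : ∑ i, p i = 1) (ha : ∑ i, p i * a i < 0) :
    ∃ r : ℝ, 0 ≤ r ∧ r < 1 ∧ ∀ (l : ℕ) (P : (Fin l → ι) → Prop) [DecidablePred P],
      (∀ v, P v → ∏ i, p (v i) ≠ 0 → 0 ≤ ∑ i, a (v i)) →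
      ∑ v, (if P v then ∏ i, p (v i) else 0) ≤ r ^ l := by
  have hder : HasDerivAt (fun τ : ℝ => ∑ i, p i * Real.exp (τ * a i)) (∑ i, p i * a i) 0 := by
    refine HasDerivAt.fun_sum fun i _ => ?_
    have h := (((hasDerivAt_id (0 : ℝ)).mul_const (a i)).exp).const_mul (p i)
    simpa using h
  obtain ⟨τ, hτ, hlt⟩ : ∃ τ : ℝ, 0 < τ ∧ ∑ i, p i * Real.exp (τ * a i) < 1 := by
    have h := (hasDerivAt_iff_tendsto_slope.1 hder).mono_left
      (nhdsWithin_mono (0 : ℝ) (show Set.Ioi (0 : ℝ) ⊆ {0}ᶜ from fun x hx => hx.ne'))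
    obtain ⟨τ, h1, h2⟩ := ((h.eventually (gt_mem_nhds ha)).and self_mem_nhdsWithin).exists
    have hτ : 0 < τ := h2
    refine ⟨τ, hτ, ?_⟩
    rw [slope_def_field, div_lt_iff₀ (by simpa using hτ)] at h1
    simp [hp1] at h1
    linarith
  refine ⟨∑ i, p i * Real.exp (τ * a i),
    Finset.sum_nonneg fun i _ => mul_nonneg (hp0 i) (Real.exp_pos _).le, hlt, ?_⟩
  intro l P _ hP
  rw [Fintype.sum_pow]
  refine Finset.sum_le_sum fun v _ => ?_
  have hnn : 0 ≤ ∏ i, p (v i) := Finset.prod_nonneg fun i _ => hp0 _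
  rw [Finset.prod_mul_distrib, ← Real.exp_sum, ← Finset.mul_sum]
  split_ifs with h
  · rcases eq_or_ne (∏ i, p (v i)) 0 with h0 | h0
    · simp [h0]
    · exact le_mul_of_one_le_right hnn (Real.one_le_exp (mul_nonneg hτ.le (hP v h h0)))
  · positivity

/-- The quantitative form of `H(p) > H(q)`: words of length `l` typical for `p` are, with a margin
which is exponentially large in `l`, less likely than words typical for `q` are numerous. -/
theorem exists_entropy_gap_rate {ι : Type*} [Fintype ι] [DecidableEq ι] (p q : ι → ℝ)
    (hp0 : ∀ i, 0 ≤ p i)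
    (hp1 : ∑ i, p i = 1) (hq0 : ∀ i, 0 ≤ q i) (hq1 : ∑ i, q i = 1)
    (hH : -∑ i, q i * Real.log (q i) < -∑ i, p i * Real.log (p i)) :
    ∃ η : ℕ → ℝ, (∀ l, 0 ≤ η l) ∧ Summable (fun l : ℕ => (l : ℝ) ^ 2 * η l) ∧
      ∀ l, ∃ S : Finset (Fin l → ι), ∃ θ : ℝ, 0 ≤ θ ∧
        ∑ v, (if v ∈ S then 0 else ∏ i, q (v i)) +
          ∑ w : Fin l → ι, (if θ < ∏ i, p (w i) then ∏ i, p (w i) else 0) + S.card * θ ≤ η l := by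
  classical
  obtain ⟨h, hqh, hhp⟩ := exists_between hH
  obtain ⟨h', hh', hhp'⟩ := exists_between hhp
  obtain ⟨r₁, h10, h11, h1⟩ := exists_chernoff_bound q (fun i => -Real.log (q i) - h) hq0 hq1 (by
    simp only [mul_sub, Finset.sum_sub_distrib, ← Finset.sum_mul, hq1, mul_neg,
      Finset.sum_neg_distrib]
    linarith)
  obtain ⟨r₂, h20, h21, h2⟩ := exists_chernoff_bound p (fun i => Real.log (p i) + h') hp0 hp1 (by
    simp only [mul_add, Finset.sum_add_distrib, ← Finset.sum_mul, hp1]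
    linarith)
  set r₃ := Real.exp (-(h' - h)) with hr₃
  have h31 : r₃ < 1 := by rw [hr₃, Real.exp_lt_one_iff]; linarith
  have h30 : 0 ≤ r₃ := (Real.exp_pos _).le
  refine ⟨fun l => r₁ ^ l + r₂ ^ l + r₃ ^ l, fun l => by positivity, ?_, fun l => ?_⟩
  · simp only [mul_add]
    have hs : ∀ r : ℝ, 0 ≤ r → r < 1 → Summable fun l : ℕ => (l : ℝ) ^ 2 * r ^ l := fun r h0 h1 =>
      summable_pow_mul_geometric_of_norm_lt_one 2 (by rwa [Real.norm_of_nonneg h0])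
    exact ((hs _ h10 h11).add (hs _ h20 h21)).add (hs _ h30 h31)
  · refine ⟨Finset.univ.filter fun v => Real.exp (-(l * h)) ≤ ∏ i, q (v i), Real.exp (-(l * h')),
      (Real.exp_pos _).le, ?_⟩
    refine add_le_add (add_le_add ?_ ?_) ?_
    · have := h1 l (fun v => ∏ i, q (v i) < Real.exp (-(l * h))) (fun v hv hne => ?_)
      · refine le_trans (le_of_eq (Finset.sum_congr rfl fun v _ => ?_)) this
        by_cases hv : ∏ i, q (v i) < Real.exp (-(l * h))
        · simp [hv]
        · simp [not_lt.1 hv, hv]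
      · have hpos : 0 < ∏ i, q (v i) :=
          lt_of_le_of_ne (Finset.prod_nonneg fun i _ => hq0 _) hne.symm
        rw [← Real.log_lt_iff_lt_exp hpos, Real.log_prod] at hv
        · simp only [Finset.sum_sub_distrib, Finset.sum_neg_distrib, Finset.sum_const,
            Finset.card_univ, Fintype.card_fin, nsmul_eq_mul]
          linarith
        · exact fun i _ => Finset.prod_ne_zero_iff.1 hne i (Finset.mem_univ _)
    · refine h2 l (fun v => Real.exp (-(l * h')) < ∏ i, p (v i)) (fun v hv hne => ?_)
      have hpos : 0 < ∏ i, p (v i) :=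
        lt_of_le_of_ne (Finset.prod_nonneg fun i _ => hp0 _) hne.symm
      rw [← Real.lt_log_iff_exp_lt hpos, Real.log_prod] at hv
      · simp only [Finset.sum_add_distrib, Finset.sum_const,
          Finset.card_univ, Fintype.card_fin, nsmul_eq_mul]
        linarith
      · exact fun i _ => Finset.prod_ne_zero_iff.1 hne i (Finset.mem_univ _)
    · set S := Finset.univ.filter fun v : Fin l → ι => Real.exp (-(l * h)) ≤ ∏ i, q (v i) with hS
      have hle : S.card * Real.exp (-(l * h)) ≤ 1 := by
        calc S.card * Real.exp (-(l * h)) = ∑ v ∈ S, Real.exp (-(l * h)) := by simp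
          _ ≤ ∑ v ∈ S, ∏ i, q (v i) :=
            Finset.sum_le_sum fun v hv => (Finset.mem_filter.1 hv).2
          _ ≤ ∑ v : Fin l → ι, ∏ i, q (v i) := Finset.sum_le_univ_sum_of_nonneg fun v =>
            Finset.prod_nonneg fun i _ => hq0 _
          _ = 1 := by rw [← Fintype.sum_pow, hq1, one_pow]
      calc S.card * Real.exp (-(l * h')) = (S.card * Real.exp (-(l * h))) * r₃ ^ l := by
            rw [hr₃, ← Real.exp_nat_mul, mul_assoc, ← Real.exp_add]; ring_nf
        _ ≤ 1 * r₃ ^ l := by gcongr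
        _ = r₃ ^ l := one_mul _

/-- A probability vector of positive entropy has a letter of probability strictly between `0` and
`1`. -/
theorem exists_mem_Ioo_of_entropy_pos {ι : Type*} [Fintype ι] (p : ι → ℝ) (hp0 : ∀ i, 0 ≤ p i)
    (hp1 : ∑ i, p i = 1) (hH : 0 < -∑ i, p i * Real.log (p i)) : ∃ b, 0 < p b ∧ p b < 1 := by
  by_contra! hcon
  have hz : ∑ i, p i * Real.log (p i) = 0 := Finset.sum_eq_zero fun i _ => by
    rcases (hp0 i).eq_or_lt with h | h
    · simp [← h]
    · have : p i = 1 := le_antisymm (hp1 ▸ Finset.single_le_sum (fun i _ => hp0 i)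
        (Finset.mem_univ i)) (hcon i h)
      simp [this]
  simp [hz] at hH

theorem entropy_nonneg {ι : Type*} [Fintype ι] (p : ι → ℝ) (hp0 : ∀ i, 0 ≤ p i)
    (hp1 : ∑ i, p i = 1) : 0 ≤ -∑ i, p i * Real.log (p i) := by
  rw [← Finset.sum_neg_distrib]
  refine Finset.sum_nonneg fun i _ => ?_
  have h1 : p i ≤ 1 := hp1 ▸ Finset.single_le_sum (fun i _ => hp0 i) (Finset.mem_univ i)
  have := mul_nonneg (hp0 i) (neg_nonneg.2 (Real.log_nonpos (hp0 i) h1))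
  linarith

/-- Strassen's theorem on a finite chain. -/
theorem exists_monotone_coupling {N : ℕ} (p q : Fin N → ℝ)
    (hp0 : ∀ i, 0 ≤ p i) (hp1 : ∑ i, p i = 1)
    (hq0 : ∀ i, 0 ≤ q i) (hq1 : ∑ i, q i = 1)
    (hdom : ∀ k : Fin N, ∑ i ∈ Finset.Iic k, p i ≤ ∑ i ∈ Finset.Iic k, q i) :
    ∃ r : Fin N → Fin N → ℝ, (∀ x y, 0 ≤ r x y) ∧ (∀ x, ∑ y, r x y = p x) ∧
      (∀ y, ∑ x, r x y = q y) ∧ ∀ x y, r x y ≠ 0 → y ≤ x := by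
  classical
  let C : (Fin N → ℝ) → ℕ → ℝ := fun p n => ∑ i : Fin N, if (i : ℕ) < n then p i else 0
  have hsucc : ∀ (p : Fin N → ℝ) (x : Fin N), C p (x + 1) - C p x = p x := by
    intro p x
    simp only [C, ← Finset.sum_sub_distrib]
    rw [Finset.sum_eq_single x]
    · simp
    · intro y _ hy
      have : (y : ℕ) ≠ x := fun h => hy (Fin.ext h)
      by_cases h : (y : ℕ) < x
      · simp [h, h.trans (Nat.lt_succ_self _)]
      · simp [h, show ¬ (y : ℕ) < x + 1 by omega]
    · simp
  have hmono : ∀ p : Fin N → ℝ, (∀ i, 0 ≤ p i) → Monotone (C p) := by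
    intro p hp m n hmn
    refine Finset.sum_le_sum fun i _ => ?_
    split_ifs with h1 h2
    · exact le_rfl
    · omega
    · exact hp i
    · exact le_rfl
  have hzero : ∀ p : Fin N → ℝ, C p 0 = 0 := fun p => by simp [C]
  have htop : ∀ p : Fin N → ℝ, C p N = ∑ i, p i := fun p => by simp [C]
  have hC : ∀ x : Fin N, C p (x + 1) ≤ C q (x + 1) := by
    intro x
    have : ∀ p : Fin N → ℝ, C p (x + 1) = ∑ i ∈ Finset.Iic x, p i := by
      intro p
      simp only [C]
      rw [← Finset.sum_filter]
      refine Finset.sum_congr ?_ fun _ _ => rfl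
      ext i
      simp only [Finset.mem_filter, Finset.mem_univ, true_and, Finset.mem_Iic, Fin.le_def]
      omega
    simpa [this] using hdom x
  let m : ℕ → ℕ → ℝ := fun i j => min (C p i) (C q j)
  refine ⟨fun x y => m (x + 1) (y + 1) - m x (y + 1) - (m (x + 1) y - m x y),
    fun x y => ?_, fun x => ?_, fun y => ?_, fun x y => ?_⟩
  · have h1 := hmono p hp0 (Nat.le_succ x)
    have h2 := hmono q hq0 (Nat.le_succ y)
    simp only [m, Nat.succ_eq_add_one] at h1 h2 ⊢
    rcases min_cases (C p (x + 1)) (C q (y + 1)) with h | h <;>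
    rcases min_cases (C p x) (C q (y + 1)) with h' | h' <;>
    rcases min_cases (C p (x + 1)) (C q y) with h3 | h3 <;>
    rcases min_cases (C p x) (C q y) with h4 | h4 <;> linarith
  · have := Finset.sum_range_sub (fun j => m (x + 1) j - m x j) N
    rw [Fin.sum_univ_eq_sum_range
      (fun j => m (x + 1) (j + 1) - m x (j + 1) - (m (x + 1) j - m x j)) N, this]
    have h1 : C p (x + 1) ≤ C q N := by rw [htop, hq1, ← hp1, ← htop]; exact hmono p hp0 x.2
    have h2 : C p x ≤ C q N := (hmono p hp0 (Nat.le_succ x)).trans h1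
    have h3 : 0 ≤ C p x := hzero p ▸ hmono p hp0 (Nat.zero_le _)
    have h4 : 0 ≤ C p (x + 1) := hzero p ▸ hmono p hp0 (Nat.zero_le _)
    simp only [m, hzero, min_eq_left h1, min_eq_left h2, min_eq_right h3, min_eq_right h4]
    linarith [hsucc p x]
  · have := Finset.sum_range_sub (fun i => m i (y + 1) - m i y) N
    have h0 : ∑ x : Fin N, (m (x + 1) (y + 1) - m x (y + 1) - (m (x + 1) y - m x y)) =
        ∑ x : Fin N, ((m (x + 1) (y + 1) - m (x + 1) y) - (m x (y + 1) - m x y)) :=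
      Finset.sum_congr rfl fun x _ => by ring
    rw [h0, Fin.sum_univ_eq_sum_range
      (fun i => (m (i + 1) (y + 1) - m (i + 1) y) - (m i (y + 1) - m i y)) N, this]
    have h1 : C q (y + 1) ≤ C p N := by rw [htop, hp1, ← hq1, ← htop]; exact hmono q hq0 y.2
    have h2 : C q y ≤ C p N := (hmono q hq0 (Nat.le_succ y)).trans h1
    have h3 : 0 ≤ C q y := hzero q ▸ hmono q hq0 (Nat.zero_le _)
    have h4 : 0 ≤ C q (y + 1) := hzero q ▸ hmono q hq0 (Nat.zero_le _)
    simp only [m, hzero, min_eq_right h1, min_eq_right h2, min_eq_left h3, min_eq_left h4]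
    linarith [hsucc q y]
  · intro hne
    by_contra! hlt
    apply hne
    have h1 : C p (x + 1) ≤ C q y := (hC x).trans (hmono q hq0 hlt)
    have h2 : C q y ≤ C q (y + 1) := hmono q hq0 (Nat.le_succ _)
    have h3 : C p x ≤ C p (x + 1) := hmono p hp0 (Nat.le_succ _)
    simp only [m, min_eq_left h1, min_eq_left (h1.trans h2), min_eq_left (h3.trans h1),
      min_eq_left (h3.trans (h1.trans h2))]
    ring

/-- Sets of words are all measurable. -/
instance List.instMeasurableSpaceTop (α : Type*) : MeasurableSpace (List α) := ⊤

instance List.instDiscreteMeasurableSpaceTop (α : Type*) : DiscreteMeasurableSpace (List α) :=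
  ⟨fun _ => trivial⟩

section Words

variable {α β : Type*}

/-- The law of the concatenation of two independent random words. -/
noncomputable def concatMeasure (S U : Measure (List α)) : Measure (List α) :=
  S.bind fun a => U.map (a ++ ·)

theorem lintegral_concatMeasure (S U : Measure (List α)) (h : List α → ℝ≥0∞) :
    ∫⁻ c, h c ∂concatMeasure S U = ∫⁻ a, ∫⁻ b, h (a ++ b) ∂U ∂S := by
  rw [concatMeasure, Measure.lintegral_bind (Measurable.of_discrete.aemeasurable)
    (Measurable.of_discrete.aemeasurable)]
  simp_rw [lintegral_map (Measurable.of_discrete (f := h)) Measurable.of_discrete]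

theorem concatMeasure_apply (S U : Measure (List α)) (s : Set (List α)) :
    concatMeasure S U s = ∫⁻ a, U {b | a ++ b ∈ s} ∂S := by
  rw [concatMeasure, Measure.bind_apply (.of_discrete) (Measurable.of_discrete.aemeasurable)]
  refine lintegral_congr fun a => ?_
  rw [Measure.map_apply .of_discrete .of_discrete]
  rfl

theorem concatMeasure_sum {ι : Type*} [Countable ι] (S : Measure (List α))
    (U : ι → Measure (List α)) :
    concatMeasure S (Measure.sum U) = Measure.sum fun n => concatMeasure S (U n) := by
  ext s hs
  simp only [concatMeasure_apply, Measure.sum_apply _ (MeasurableSet.of_discrete)]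
  exact lintegral_tsum fun i => Measurable.of_discrete.aemeasurable

theorem map_concatMeasure (S U : Measure (List α)) (g : α → β) :
    (concatMeasure S U).map (List.map g) =
      concatMeasure (S.map (List.map g)) (U.map (List.map g)) := by
  ext s hs
  rw [Measure.map_apply .of_discrete hs, concatMeasure_apply, concatMeasure_apply,
    lintegral_map .of_discrete .of_discrete]
  refine lintegral_congr fun a => ?_
  rw [Measure.map_apply .of_discrete .of_discrete]
  simp

/-- The renewal measure: a word of law `T` preceded by an arbitrary number of independent words of
law `S`. -/
noncomputable def renewalMeasure (S T : Measure (List α)) : Measure (List α) :=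
  Measure.sum fun n => (concatMeasure S)^[n] T

theorem renewalMeasure_eq (S T : Measure (List α)) :
    renewalMeasure S T = T + concatMeasure S (renewalMeasure S T) := by
  rw [renewalMeasure, concatMeasure_sum]
  ext s hs
  rw [Measure.add_apply, Measure.sum_apply _ hs, Measure.sum_apply _ hs,
    tsum_eq_zero_add' ENNReal.summable]
  simp only [Function.iterate_succ_apply', Function.iterate_zero, id]

theorem map_renewalMeasure (S T : Measure (List α)) (g : α → β) :
    (renewalMeasure S T).map (List.map g) =
      renewalMeasure (S.map (List.map g)) (T.map (List.map g)) := by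
  rw [renewalMeasure, Measure.map_sum (Measurable.of_discrete.aemeasurable), renewalMeasure]
  congr 1
  funext n
  induction n with
  | zero => rfl
  | succ n ih => simp only [Function.iterate_succ_apply', map_concatMeasure, ih]

/-- Wald's identity for additive functionals of a renewal measure. -/
theorem lintegral_renewalMeasure {S T : Measure (List α)} {s c : ℝ≥0∞} (hS : S Set.univ = s)
    (hsc : s + c = 1) (hc : c ≠ 0) (h hd : List α → ℝ≥0∞)
    (hadd : ∀ᵐ a ∂S, ∀ᵐ b ∂renewalMeasure S T, h (a ++ b) = hd a + h b) :
    c * ∫⁻ w, h w ∂renewalMeasure S T =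
      ∫⁻ w, h w ∂T + (∫⁻ w, hd w ∂S) * renewalMeasure S T Set.univ := by
  have hc1 : c ≠ ∞ := fun h => by simp [h] at hsc
  have hs1 : s ≠ ∞ := fun h => by simp [h] at hsc
  have key : ∀ U : Measure (List α), U ≪ renewalMeasure S T →
      ∫⁻ w, h w ∂concatMeasure S U = (∫⁻ w, hd w ∂S) * U Set.univ + s * ∫⁻ w, h w ∂U := by
    intro U hU
    rw [lintegral_concatMeasure]
    have h1 : ∀ᵐ a ∂S, ∫⁻ b, h (a ++ b) ∂U = hd a * U Set.univ + ∫⁻ w, h w ∂U := by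
      filter_upwards [hadd] with a ha
      rw [lintegral_congr_ae (hU.ae_le ha), lintegral_add_left .of_discrete, lintegral_const]
    rw [lintegral_congr_ae h1, lintegral_add_left .of_discrete, lintegral_const, hS,
      lintegral_mul_const _ .of_discrete, mul_comm s]
  set C := ∫⁻ w, h w ∂T + (∫⁻ w, hd w ∂S) * renewalMeasure S T Set.univ with hC
  set X := ∫⁻ w, h w ∂renewalMeasure S T with hX
  have hXeq : X = C + s * X := by
    conv_lhs => rw [hX, renewalMeasure_eq, lintegral_add_measure, key _ (Measure.AbsolutelyContinuous.rfl)]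
    rw [hC, add_assoc]
  have hle : X ≤ C / c := by
    have hD : C + s * (C / c) = C / c := by
      have : C = c * (C / c) := (ENNReal.mul_div_cancel hc hc1).symm
      calc C + s * (C / c) = c * (C / c) + s * (C / c) := by rw [← this]
        _ = C / c := by rw [← add_mul, add_comm c, hsc, one_mul]
    have hac : ∀ n, (concatMeasure S)^[n] T ≪ renewalMeasure S T := fun n =>
      (Measure.le_sum (fun n => (concatMeasure S)^[n] T) n).absolutelyContinuous
    rw [hX, renewalMeasure, lintegral_sum_measure]
    refine ENNReal.tsum_le_of_sum_range_le fun n => ?_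
    induction n with
    | zero => simp
    | succ n ih =>
      rw [Finset.sum_range_succ']
      simp only [Function.iterate_succ_apply', key _ (hac _), Finset.sum_add_distrib,
        ← Finset.mul_sum]
      rw [← hD, hC, Function.iterate_zero, id, add_comm, add_assoc]
      gcongr
      rw [renewalMeasure, Measure.sum_apply _ .univ]
      exact ENNReal.sum_le_tsum _
  rcases eq_or_ne X ∞ with hinf | hfin
  · rw [hinf, top_le_iff] at hle
    have : C = ∞ := by
      by_contra hne
      exact (ENNReal.div_lt_top hne hc).ne hle
    rw [hinf, this, ENNReal.mul_top hc]
  · have h1 : c * X + s * X = C + s * X := by rw [← add_mul, add_comm c, hsc, one_mul, ← hXeq]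
    exact (ENNReal.add_left_inj (ENNReal.mul_ne_top hs1 hfin)).1 h1

theorem mul_renewalMeasure_univ {S T : Measure (List α)} {s c : ℝ≥0∞} (hS : S Set.univ = s)
    (hsc : s + c = 1) (hc : c ≠ 0) :
    c * renewalMeasure S T Set.univ = T Set.univ := by
  simpa using lintegral_renewalMeasure (T := T) hS hsc hc (fun _ => 1) (fun _ => 0) (by simp)

/-- A property which holds for the words of laws `S` and `T` and is stable under concatenation holds
for the renewal measure. -/
theorem ae_renewalMeasure {S T : Measure (List α)} {P Q : List α → Prop} (hS : ∀ᵐ a ∂S, Q a)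
    (hT : ∀ᵐ b ∂T, P b) (hadd : ∀ a b, Q a → P b → P (a ++ b)) :
    ∀ᵐ w ∂renewalMeasure S T, P w := by
  rw [renewalMeasure, Measure.ae_sum_iff]
  intro n
  induction n with
  | zero => exact hT
  | succ n ih =>
    rw [Function.iterate_succ_apply', ae_iff, concatMeasure_apply, lintegral_eq_zero_iff .of_discrete]
    filter_upwards [hS] with a ha
    exact measure_mono_null (fun b hb hPb => hb (hadd a b ha hPb)) ih

end Words

section Blocks

variable {A : Type*}

/-- The word of length `l` read in the sequence `x` from position `s` on. -/
def window (x : ℤ → A) (s : ℤ) (l : ℕ) : List A := (List.range l).map fun i : ℕ => x (s + i)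

@[simp] theorem length_window (x : ℤ → A) (s : ℤ) (l : ℕ) : (window x s l).length = l := by
  simp [window]

theorem window_add (x : ℤ → A) (s : ℤ) (m n : ℕ) :
    window x s (m + n) = window x s m ++ window x (s + m) n := by
  simp [window, List.range_add, add_assoc]

theorem map_window {B : Type*} (g : B → A) (z : ℤ → B) (s : ℤ) (l : ℕ) :
    (window z s l).map g = window (g ∘ z) s l := by
  simp [window]

theorem window_eq_iff {x : ℤ → A} {s : ℤ} {w : List A} :
    window x s w.length = w ↔ ∀ i (h : i < w.length), x (s + i) = w[i] := by
  constructor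
  · intro h i hi
    have : (window x s w.length)[i]'(by simpa using hi) = w[i] := by
      simp only [h]
    simpa [window] using this
  · intro h
    refine List.ext_getElem (by simp) fun i h1 h2 => ?_
    simp [window, h i h2]

theorem window_append {x : ℤ → A} {s : ℤ} {u w : List A} :
    window x s (u ++ w).length = u ++ w ↔
      window x s u.length = u ∧ window x (s + u.length) w.length = w := by
  rw [List.length_append, window_add]
  constructor
  · exact fun h => List.append_inj h (by simp)
  · rintro ⟨h1, h2⟩
    rw [h1, h2]

variable (b : A)

/-- The marker blocks of level `k`. A block of level `0` is a word ending with its only occurrence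
of `b`, and a block of level `k + 1` is a maximal concatenation of blocks of level `k` in which only
the last one has positive excess; the excess `j` of a block of level `k` is such that `b` is preceded
by exactly `k + j` letters other than `b` at the end of the block. -/
inductive IsMarkerBlock : ℕ → ℕ → List A → Prop
  | base (n : List A) (hn : b ∉ n) : IsMarkerBlock 0 n.length (n ++ [b])
  | lift {k j : ℕ} {w : List A} (hw : IsMarkerBlock k (j + 1) w) : IsMarkerBlock (k + 1) j w
  | cons {k j : ℕ} {u w : List A} (hu : IsMarkerBlock k 0 u) (hw : IsMarkerBlock (k + 1) j w) :
      IsMarkerBlock (k + 1) j (u ++ w)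

/-- The position `s` is a cut of level `k` of `x` if it comes just after an occurrence of `b`, which
is itself preceded by at least `k` other letters. -/
def IsCut (k : ℕ) (x : ℤ → A) (s : ℤ) : Prop :=
  x (s - 1) = b ∧ ∀ i : ℕ, 1 ≤ i → i ≤ k → x (s - 1 - i) ≠ b

variable {b} {k j j' : ℕ} {u v w : List A} {x : ℤ → A} {s : ℤ}

theorem IsCut.mono (h : IsCut b j x s) (hkj : k ≤ j) : IsCut b k x s :=
  ⟨h.1, fun i h1 h2 => h.2 i h1 (h2.trans hkj)⟩

theorem isMarkerBlock_zero_iff :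
    IsMarkerBlock b 0 j w ↔ ∃ n, b ∉ n ∧ n.length = j ∧ w = n ++ [b] := by
  constructor
  · rintro ⟨n, hn⟩
    exact ⟨n, hn, rfl, rfl⟩
  · rintro ⟨n, hn, rfl, rfl⟩
    exact .base n hn

theorem isMarkerBlock_succ_iff :
    IsMarkerBlock b (k + 1) j w ↔ IsMarkerBlock b k (j + 1) w ∨
      ∃ u v, IsMarkerBlock b k 0 u ∧ IsMarkerBlock b (k + 1) j v ∧ w = u ++ v := by
  constructor
  · intro h
    cases h with
    | lift hw => exact .inl hw
    | cons hu hw => exact .inr ⟨_, _, hu, hw, rfl⟩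
  · rintro (h | ⟨u, v, hu, hv, rfl⟩)
    exacts [.lift h, .cons hu hv]

theorem IsMarkerBlock.lt_length (h : IsMarkerBlock b k j w) : j < w.length := by
  induction h with
  | base n hn => simp
  | lift hw ih => omega
  | cons hu hw ih1 ih2 => simp; omega

theorem IsMarkerBlock.isCut (h : IsMarkerBlock b k j w) (hs : x (s - 1) = b)
    (hw : window x s w.length = w) :
    IsCut b (k + j) x (s + w.length) ∧ ¬ IsCut b (k + j + 1) x (s + w.length) ∧
      ∀ t, s < t → t < s + w.length → ¬ IsCut b k x t := by
  induction h generalizing s with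
  | base n hn =>
    rw [window_append] at hw
    obtain ⟨h1, h2⟩ := hw
    have hn' : ∀ i : ℕ, i < n.length → x (s + i) ≠ b := by
      intro i hi h
      rw [window_eq_iff.1 h1 i hi] at h
      exact hn (h ▸ List.getElem_mem hi)
    have hb : x (s + n.length) = b := by simpa using window_eq_iff.1 h2 0 (by simp)
    have hlen : (s + ((n ++ [b]).length : ℕ) : ℤ) - 1 = s + n.length := by simp; ring
    simp only [IsCut, hlen]
    refine ⟨⟨hb, fun i h1 h2 => ?_⟩, fun h => h.2 (n.length + 1) (by omega) (by omega) ?_,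
      fun t h1 h2 h => ?_⟩
    · have := hn' (n.length - i) (by omega)
      rwa [Nat.cast_sub (by omega), add_sub_assoc'] at this
    · rw [← hs]
      congr 1
      push_cast
      ring
    · have h3 := hn' (t - 1 - s).toNat (by simp at h2; omega)
      rw [Int.toNat_of_nonneg (by omega)] at h3
      exact h3 (by rw [add_sub_cancel]; exact h.1)
  | @lift k j w hw ih =>
    obtain ⟨h1, h2, h3⟩ := ih hs hw
    refine ⟨by rwa [show k + 1 + j = k + (j + 1) by ring],
      by rwa [show k + 1 + j + 1 = k + (j + 1) + 1 by ring],
      fun t ht ht' h => h3 t ht ht' (h.mono (Nat.le_succ k))⟩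
  | @cons k j u w hu hw ihu ihw =>
    rw [window_append] at hw
    obtain ⟨h1, h2, h3⟩ := ihu hs hw.1
    obtain ⟨h4, h5, h6⟩ := ihw h1.1 hw.2
    have hlen : (s + ((u ++ w).length : ℕ) : ℤ) = s + u.length + w.length := by
      simp [add_assoc]
    rw [hlen]
    refine ⟨h4, h5, fun t ht ht' h => ?_⟩
    rcases lt_trichotomy t (s + u.length) with h7 | rfl | h7
    · exact h3 t ht h7 (h.mono (Nat.le_succ k))
    · exact h2 h
    · exact h6 t h7 ht' h

/-- A block read in `x` just after an occurrence of the marker is determined by its position. -/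
theorem IsMarkerBlock.length_eq {l l' : ℕ} (h : IsMarkerBlock b k j (window x s l))
    (h' : IsMarkerBlock b k j' (window x s l')) (hs : x (s - 1) = b) : l = l' ∧ j = j' := by
  have hN := h.isCut hs (by simp)
  have hN' := h'.isCut hs (by simp)
  have hl := h.lt_length
  have hl' := h'.lt_length
  simp only [length_window] at hN hN' hl hl'
  obtain rfl : l = l' := by
    rcases lt_trichotomy l l' with h1 | h1 | h1
    · exact absurd (hN.1.mono (Nat.le_add_right k j)) (hN'.2.2 _ (by omega) (by omega))
    · exact h1
    · exact absurd (hN'.1.mono (Nat.le_add_right k j')) (hN.2.2 _ (by omega) (by omega))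
  refine ⟨rfl, ?_⟩
  by_contra hne
  rcases lt_or_gt_of_ne hne with h1 | h1
  · exact hN.2.1 (hN'.1.mono (by omega))
  · exact hN'.2.1 (hN.1.mono (by omega))

theorem IsMarkerBlock.eq_of_append (h : IsMarkerBlock b k j u) (h' : IsMarkerBlock b k j' (u ++ v)) :
    v = [] ∧ j = j' := by
  classical
  let x : ℤ → A := fun i => if i < 0 then b else (u ++ v).getD i.toNat b
  have h1 : window x 0 (u ++ v).length = u ++ v := by
    rw [window_eq_iff]
    intro i hi
    simp only [x, zero_add, Int.toNat_natCast, Int.natCast_nonneg, not_lt.2, if_false]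
    exact List.getD_eq_getElem _ _ hi
  have h2 := (window_append.1 h1).1
  obtain ⟨h3, h4⟩ := IsMarkerBlock.length_eq (x := x) (s := 0) (by rwa [h2]) (by rwa [h1]) (by simp [x])
  exact ⟨by simpa using h3, h4⟩

/-- No level-`k` block is a proper beginning of another one, and the excess is determined by the block. -/
theorem IsMarkerBlock.append_inj {u' v' : List A} (h : IsMarkerBlock b k j u)
    (h' : IsMarkerBlock b k j' u') (heq : u ++ v = u' ++ v') : u = u' ∧ v = v' ∧ j = j' := by
  rcases List.append_eq_append_iff.1 heq with ⟨a, rfl, rfl⟩ | ⟨a, rfl, rfl⟩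
  · obtain ⟨rfl, rfl⟩ := h.eq_of_append h'
    simp
  · obtain ⟨rfl, rfl⟩ := h'.eq_of_append h
    simp

/-- The position `s` is the start of a block of level `k`, excess `j` and length `l` in `x`. -/
def IsBlockAt (b : A) (k j : ℕ) (x : ℤ → A) (s : ℤ) (l : ℕ) : Prop :=
  IsCut b k x s ∧ IsMarkerBlock b k j (window x s l)

/-- A position is covered by at most one block of each level. -/
theorem IsBlockAt.unique {p s' : ℤ} {l l' : ℕ} (h : IsBlockAt b k j x s l)
    (h' : IsBlockAt b k j' x s' l') (hs : s ≤ p) (hp : p < s + l) (hs' : s' ≤ p)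
    (hp' : p < s' + l') : s = s' ∧ l = l' ∧ j = j' := by
  have hN := h.2.isCut h.1.1 (by simp)
  have hN' := h'.2.isCut h'.1.1 (by simp)
  simp only [length_window] at hN hN'
  obtain rfl : s = s' := by
    rcases lt_trichotomy s s' with h1 | h1 | h1
    · exact absurd h'.1 (hN.2.2 _ h1 (by omega))
    · exact h1
    · exact absurd h.1 (hN'.2.2 _ h1 (by omega))
  exact ⟨rfl, h.2.length_eq h'.2 h.1.1⟩

theorem isCut_iff_isMarkerBlock :
    IsCut b k x s ↔ IsMarkerBlock b 0 k (window x (s - (k + 1)) (k + 1)) := by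
  rw [isMarkerBlock_zero_iff]
  have hsplit : window x (s - (k + 1)) (k + 1) = window x (s - (k + 1)) k ++ [x (s - 1)] := by
    rw [window_add]
    have : s - (k + 1) + k = s - 1 := by ring
    simp [window, this]
  rw [hsplit]
  constructor
  · rintro ⟨h1, h2⟩
    refine ⟨_, ?_, length_window _ _ _, by rw [h1]⟩
    simp only [window, List.mem_map, List.mem_range, not_exists, not_and]
    intro i hi
    convert h2 (k - i) (by omega) (by omega) using 3
    rw [Nat.cast_sub hi.le]
    ring
  · rintro ⟨n, hn, hl, heq⟩
    obtain ⟨rfl, h2⟩ := List.append_inj heq (by simp [hl])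
    refine ⟨by simpa using h2, fun i h1 h3 h4 => hn ?_⟩
    simp only [window, List.mem_map, List.mem_range]
    refine ⟨k - i, by omega, ?_⟩
    rw [← h4, Nat.cast_sub h3]
    congr 1
    ring

end Blocks

section BlockMeasure

variable {A B : Type*} [MeasurableSpace B]

/-- The measure on the set of all words giving each word the product of the masses of its
letters. -/
noncomputable def wordMeasure (ρ : Measure B) : Measure (List B) :=
  renewalMeasure (ρ.map fun c => [c]) (Measure.dirac [])

/-- The restriction of the measure `wordMeasure ρ` to the marker blocks. -/
noncomputable def blockMeasure (ρ : Measure B) (π : B → A) (b : A) (k j : ℕ) : Measure (List B) :=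
  (wordMeasure ρ).restrict {ζ | IsMarkerBlock b k j (ζ.map π)}

section

variable (ρ : Measure B) (π : B → A) (b : A) (k j : ℕ)

theorem ae_blockMeasure : ∀ᵐ ζ ∂blockMeasure ρ π b k j, IsMarkerBlock b k j (ζ.map π) :=
  ae_restrict_mem .of_discrete

theorem blockMeasure_le : blockMeasure ρ π b k j ≤ wordMeasure ρ := Measure.restrict_le_self

variable {k j} in
theorem blockMeasure_singleton {ζ : List B} (h : IsMarkerBlock b k j (ζ.map π)) :
    blockMeasure ρ π b k j {ζ} = wordMeasure ρ {ζ} :=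
  Measure.restrict_eq_self _ (by simpa using h)

variable {k j} in
theorem blockMeasure_singleton_of_not {ζ : List B} (h : ¬ IsMarkerBlock b k j (ζ.map π)) :
    blockMeasure ρ π b k j {ζ} = 0 :=
  measure_eq_zero_iff_ae_notMem.2 (by
    filter_upwards [ae_blockMeasure ρ π b k j] with ξ hξ h1
    exact h (h1 ▸ hξ))

end

variable [DiscreteMeasurableSpace B]

theorem wordMeasure_apply (ρ : Measure B) (s : Set (List B)) :
    wordMeasure ρ s = Measure.dirac [] s + ∫⁻ c, wordMeasure ρ {w | c :: w ∈ s} ∂ρ := by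
  conv_lhs => rw [wordMeasure, renewalMeasure_eq, ← wordMeasure, Measure.add_apply,
    concatMeasure_apply, lintegral_map .of_discrete .of_discrete]
  rfl

theorem wordMeasure_nil (ρ : Measure B) : wordMeasure ρ {[]} = 1 := by
  rw [wordMeasure_apply]
  simp

theorem wordMeasure_cons (ρ : Measure B) (c : B) (w : List B) :
    wordMeasure ρ {c :: w} = ρ {c} * wordMeasure ρ {w} := by
  rw [wordMeasure_apply]
  have h : ∀ d, wordMeasure ρ {v | d :: v ∈ ({c :: w} : Set (List B))} =
      ({c} : Set B).indicator (fun _ => wordMeasure ρ {w}) d := by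
    intro d
    by_cases hd : d = c
    · simp [hd]
    · simp [hd]
  simp_rw [h]
  rw [lintegral_indicator_const .of_discrete]
  simp [mul_comm]

theorem wordMeasure_singleton (ρ : Measure B) (w : List B) :
    wordMeasure ρ {w} = (w.map fun c => ρ {c}).prod := by
  induction w with
  | nil => simp [wordMeasure_nil]
  | cons c w ih => simp [wordMeasure_cons, ih]

theorem wordMeasure_append (ρ : Measure B) (u v : List B) :
    wordMeasure ρ {u ++ v} = wordMeasure ρ {u} * wordMeasure ρ {v} := by
  simp [wordMeasure_singleton]

theorem map_wordMeasure [MeasurableSpace A] [DiscreteMeasurableSpace A] (ρ : Measure B)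
    (g : B → A) : (wordMeasure ρ).map (List.map g) = wordMeasure (ρ.map g) := by
  rw [wordMeasure, map_renewalMeasure, wordMeasure, Measure.map_map .of_discrete .of_discrete,
    Measure.map_map .of_discrete .of_discrete, Measure.map_dirac' (f := List.map g) .of_discrete]
  rfl

theorem ae_wordMeasure {ρ : Measure B} {P : B → Prop} (h : ∀ᵐ c ∂ρ, P c) :
    ∀ᵐ w ∂wordMeasure ρ, ∀ c ∈ w, P c := by
  refine ae_renewalMeasure (Q := fun w => ∀ c ∈ w, P c) ?_ ?_ ?_
  · rw [ae_map_iff (Measurable.of_discrete.aemeasurable) .of_discrete]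
    simpa using h
  · simp [ae_dirac_eq]
  · intro u v hu hv c hc
    exact (List.mem_append.1 hc).elim (hu c) (hv c)

variable (ρ : Measure B) (π : B → A) (b : A) (k j : ℕ)

theorem blockMeasure_zero_zero_univ : blockMeasure ρ π b 0 0 Set.univ = ρ (π ⁻¹' {b}) := by
  rw [blockMeasure, Measure.restrict_apply_univ, wordMeasure_apply]
  have h : ∀ c, wordMeasure ρ {w | c :: w ∈ {ζ : List B | IsMarkerBlock b 0 0 (ζ.map π)}} =
      (π ⁻¹' {b}).indicator (fun _ => 1) c := by
    intro c
    by_cases hc : π c = b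
    · rw [Set.indicator_of_mem (by simpa using hc), ← wordMeasure_nil ρ]
      congr 1
      ext w
      simp [isMarkerBlock_zero_iff, hc]
    · rw [Set.indicator_of_notMem (by simpa using hc), ← measure_empty (μ := wordMeasure ρ)]
      congr 1
      ext w
      simp [isMarkerBlock_zero_iff, hc]
  simp_rw [h]
  rw [lintegral_indicator_const .of_discrete]
  simp [isMarkerBlock_zero_iff]

theorem blockMeasure_zero_succ_univ : blockMeasure ρ π b 0 (j + 1) Set.univ =
    ρ (π ⁻¹' {b})ᶜ * blockMeasure ρ π b 0 j Set.univ := by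
  rw [blockMeasure, Measure.restrict_apply_univ, wordMeasure_apply]
  have h : ∀ c, wordMeasure ρ {w | c :: w ∈ {ζ : List B | IsMarkerBlock b 0 (j + 1) (ζ.map π)}} =
      (π ⁻¹' {b})ᶜ.indicator (fun _ => blockMeasure ρ π b 0 j Set.univ) c := by
    intro c
    by_cases hc : π c = b
    · rw [Set.indicator_of_notMem (by simpa using hc), ← measure_empty (μ := wordMeasure ρ)]
      congr 1
      ext w
      simp only [isMarkerBlock_zero_iff, List.map_cons, Set.mem_ofPred_eq, Set.mem_empty_iff_false,
        iff_false, not_exists, not_and]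
      rintro (_ | ⟨d, n⟩) hn hl heq
      · simp at hl
      · simp only [List.cons_append, List.cons.injEq] at heq
        exact hn (by simp [← heq.1, hc])
    · rw [Set.indicator_of_mem (by simpa using hc), blockMeasure, Measure.restrict_apply_univ]
      congr 1
      ext w
      simp only [isMarkerBlock_zero_iff, List.map_cons, Set.mem_ofPred_eq]
      constructor
      · rintro ⟨_ | ⟨d, n⟩, hn, hl, heq⟩
        · simp at hl
        · simp only [List.cons_append, List.cons.injEq] at heq
          exact ⟨n, fun h => hn (List.mem_cons_of_mem _ h), by simpa using hl, heq.2⟩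
      · rintro ⟨n, hn, hl, heq⟩
        exact ⟨π c :: n, by simp [hn, Ne.symm hc], by simp [hl], by simp [heq]⟩
  simp_rw [h]
  rw [lintegral_indicator_const .of_discrete]
  simp [isMarkerBlock_zero_iff, mul_comm]

variable [Countable B]

/-- A block of level `k + 1` is a renewal sequence of blocks of level `k`. -/
theorem blockMeasure_succ : blockMeasure ρ π b (k + 1) j =
    renewalMeasure (blockMeasure ρ π b k 0) (blockMeasure ρ π b k (j + 1)) := by
  refine Measure.ext_of_singleton fun ζ => ?_
  induction hn : ζ.length using Nat.strong_induction_on generalizing ζ with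
  | _ n ih =>
  subst hn
  rw [renewalMeasure_eq, Measure.add_apply, concatMeasure_apply]
  set R := renewalMeasure (blockMeasure ρ π b k 0) (blockMeasure ρ π b k (j + 1)) with hR
  by_cases hsplit : ∃ u v, IsMarkerBlock b k 0 (u.map π) ∧ ζ = u ++ v
  · obtain ⟨u, v, hu, rfl⟩ := hsplit
    have h1 : ¬ IsMarkerBlock b k (j + 1) ((u ++ v).map π) := by
      intro h
      rw [List.map_append] at h
      simpa using (hu.eq_of_append h).2
    have h2 : ∀ᵐ a ∂blockMeasure ρ π b k 0, R {c | a ++ c ∈ ({u ++ v} : Set (List B))} =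
        ({u} : Set (List B)).indicator (fun _ => R {v}) a := by
      filter_upwards [ae_blockMeasure ρ π b k 0] with a ha
      by_cases hau : a = u
      · simp [hau]
      · rw [Set.indicator_of_notMem (by simpa using hau), ← measure_empty (μ := R)]
        congr 1
        ext c
        simp only [Set.mem_ofPred_eq, Set.mem_singleton_iff, Set.mem_empty_iff_false, iff_false]
        intro heq
        have := (ha.append_inj hu (v := c.map π) (v' := v.map π)
          (by simp only [← List.map_append, heq])).1
        exact hau (List.append_inj heq (by simpa using congrArg List.length this)).1
    have hlen := hu.lt_length
    rw [lintegral_congr_ae h2, lintegral_indicator_const .of_discrete, blockMeasure_singleton _ _ _ hu,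
      blockMeasure_singleton_of_not _ _ _ h1, zero_add, ← ih v.length (by simp at hlen ⊢; omega) v rfl]
    by_cases hv : IsMarkerBlock b (k + 1) j (v.map π)
    · rw [blockMeasure_singleton _ _ _ hv, blockMeasure_singleton, wordMeasure_append, mul_comm]
      rw [List.map_append]
      exact .cons hu hv
    · rw [blockMeasure_singleton_of_not _ _ _ hv, blockMeasure_singleton_of_not, zero_mul]
      rw [isMarkerBlock_succ_iff]
      rintro (h | ⟨u', v', hu', hv', heq⟩)
      · exact h1 h
      · rw [List.map_append] at heq
        exact hv ((hu.append_inj hu' heq).2.1 ▸ hv')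
  · have h2 : ∀ᵐ a ∂blockMeasure ρ π b k 0, R {c | a ++ c ∈ ({ζ} : Set (List B))} = 0 := by
      filter_upwards [ae_blockMeasure ρ π b k 0] with a ha
      rw [← measure_empty (μ := R)]
      congr 1
      ext c
      simp only [Set.mem_ofPred_eq, Set.mem_singleton_iff, Set.mem_empty_iff_false, iff_false]
      exact fun heq => hsplit ⟨a, c, ha, heq.symm⟩
    rw [lintegral_congr_ae h2, lintegral_zero, add_zero]
    by_cases hζ : IsMarkerBlock b k (j + 1) (ζ.map π)
    · rw [blockMeasure_singleton _ _ _ hζ, blockMeasure_singleton _ _ _ (.lift hζ)]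
    · rw [blockMeasure_singleton_of_not _ _ _ hζ, blockMeasure_singleton_of_not]
      rw [isMarkerBlock_succ_iff]
      rintro (h | ⟨u, v, hu, hv, heq⟩)
      · exact hζ h
      · obtain ⟨u', v', rfl, rfl, rfl⟩ := List.map_eq_append_iff.1 heq
        exact hsplit ⟨u', v', hu, rfl⟩

variable [IsProbabilityMeasure ρ]

theorem blockMeasure_univ (hb : ρ (π ⁻¹' {b})ᶜ ≠ 0) :
    blockMeasure ρ π b k j Set.univ = ρ (π ⁻¹' {b})ᶜ ^ j * ρ (π ⁻¹' {b}) := by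
  induction k generalizing j with
  | zero =>
    induction j with
    | zero => simp [blockMeasure_zero_zero_univ]
    | succ j ih => rw [blockMeasure_zero_succ_univ, ih, pow_succ']; ring
  | succ k ih =>
    have h0 := ih 0
    rw [pow_zero, one_mul] at h0
    have := mul_renewalMeasure_univ (T := blockMeasure ρ π b k (j + 1)) h0
      (prob_add_prob_compl .of_discrete) hb
    rw [← blockMeasure_succ, ih, pow_succ', mul_assoc] at this
    exact (ENNReal.mul_right_inj hb (measure_ne_top _ _)).1 this

theorem tsum_blockMeasure_univ (hb : ρ (π ⁻¹' {b})ᶜ ≠ 0) (hb' : ρ (π ⁻¹' {b}) ≠ 0) :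
    ∑' j, blockMeasure ρ π b k j Set.univ = 1 := by
  simp_rw [blockMeasure_univ ρ π b k _ hb, ENNReal.tsum_mul_right, ENNReal.tsum_geometric]
  have h : 1 - ρ (π ⁻¹' {b})ᶜ = ρ (π ⁻¹' {b}) :=
    ENNReal.sub_eq_of_eq_add (measure_ne_top _ _) (prob_add_prob_compl .of_discrete).symm
  rw [h, ENNReal.inv_mul_cancel hb' (measure_ne_top _ _)]

/-- The probability that a given position is a cut of level `k`. -/
noncomputable def cutProb (ρ : Measure B) (π : B → A) (b : A) (k : ℕ) : ℝ≥0∞ :=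
  ρ (π ⁻¹' {b})ᶜ ^ k * ρ (π ⁻¹' {b})

/-- The mean length of the blocks is at least the inverse of the density of the cuts. -/
theorem one_le_cutProb_mul_tsum_lintegral_length (hb : ρ (π ⁻¹' {b})ᶜ ≠ 0)
    (hb' : ρ (π ⁻¹' {b}) ≠ 0) :
    1 ≤ cutProb ρ π b k * ∑' j, ∫⁻ ζ, ζ.length ∂blockMeasure ρ π b k j := by
  set γ := ρ (π ⁻¹' {b})ᶜ with hγ
  set β := ρ (π ⁻¹' {b}) with hβ
  have hβγ : β + γ = 1 := prob_add_prob_compl .of_discrete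
  induction k with
  | zero =>
    have h1 : ∀ j, ∫⁻ ζ, ζ.length ∂blockMeasure ρ π b 0 j =
        γ ^ j * β + j * (γ ^ j * β) := by
      intro j
      have : ∀ᵐ ζ ∂blockMeasure ρ π b 0 j, (ζ.length : ℝ≥0∞) = 1 + j := by
        filter_upwards [ae_blockMeasure ρ π b 0 j] with ζ hζ
        obtain ⟨n, hn, hl, heq⟩ := isMarkerBlock_zero_iff.1 hζ
        have := congrArg List.length heq
        simp only [List.length_map, List.length_append, List.length_singleton, hl] at this
        rw [this]
        push_cast
        ring
      rw [lintegral_congr_ae this, lintegral_const, blockMeasure_univ ρ π b 0 j hb, add_mul, one_mul]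
    have h2 : ∑' j, γ ^ j * β = 1 := by
      simpa only [blockMeasure_univ ρ π b 0 _ hb] using tsum_blockMeasure_univ ρ π b 0 hb hb'
    simp only [h1, cutProb, pow_zero, one_mul]
    set Y := ∑' j : ℕ, (γ ^ j * β + j * (γ ^ j * β)) with hY
    have h3 : Y = 1 + γ * Y := by
      conv_lhs => rw [hY, ENNReal.tsum_add, h2, tsum_eq_zero_add' ENNReal.summable]
      rw [hY, ← ENNReal.tsum_mul_left]
      simp only [Nat.cast_zero, zero_mul, zero_add]
      congr 2
      ext j
      push_cast
      ring
    rcases eq_or_ne Y ∞ with h | h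
    · rw [h, ENNReal.mul_top hb']; exact le_top
    · have h4 : β * Y + γ * Y = 1 + γ * Y := by rw [← add_mul, hβγ, one_mul, ← h3]
      exact ((ENNReal.add_left_inj (ENNReal.mul_ne_top (measure_ne_top _ _) h)).1 h4).ge
  | succ k ih =>
    have h1 : ∀ j, γ * ∫⁻ ζ, ζ.length ∂blockMeasure ρ π b (k + 1) j =
        ∫⁻ ζ, ζ.length ∂blockMeasure ρ π b k (j + 1) +
          (∫⁻ ζ, ζ.length ∂blockMeasure ρ π b k 0) * blockMeasure ρ π b (k + 1) j Set.univ := by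
      intro j
      rw [blockMeasure_succ]
      exact lintegral_renewalMeasure (by simpa using blockMeasure_univ ρ π b k 0 hb) hβγ hb _ _
        (by simp)
    have h2 : cutProb ρ π b (k + 1) = cutProb ρ π b k * γ := by
      rw [cutProb, cutProb, pow_succ]; ring
    rw [h2, mul_assoc, ← ENNReal.tsum_mul_left]
    simp only [h1]
    rw [ENNReal.tsum_add, ENNReal.tsum_mul_left, tsum_blockMeasure_univ ρ π b _ hb hb', mul_one,
      add_comm, ← tsum_eq_zero_add' (f := fun j => ∫⁻ ζ, ζ.length ∂blockMeasure ρ π b k j)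
        ENNReal.summable]
    exact ih

end BlockMeasure

section WindowLaw

variable {A B : Type*} [MeasurableSpace B] [DiscreteMeasurableSpace B] [Countable B]

theorem measurable_window (s : ℤ) (l : ℕ) : Measurable fun z : ℤ → B => window z s l := by
  have h : (fun z : ℤ → B => window z s l) =
      (fun v : Fin l → B => List.ofFn v) ∘ fun z i => z (s + (i : ℕ)) := by
    funext z
    refine List.ext_getElem (by simp) fun i h1 h2 => by simp [window]
  rw [h]
  exact Measurable.of_discrete.comp (measurable_pi_iff.2 fun i => measurable_pi_apply _)

/-- The windows of `z` of law `ν` are words of independent letters of law `ρ`. -/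
def HasWindowLaw (ν : Measure (ℤ → B)) (ρ : Measure B) : Prop :=
  ∀ (s : ℤ) (ζ : List B), ν {z | window z s ζ.length = ζ} = wordMeasure ρ {ζ}

theorem ext_of_window {μ ν : Measure (ℤ → B)} [IsProbabilityMeasure μ] [IsProbabilityMeasure ν]
    (h : ∀ (s : ℤ) (ζ : List B),
      μ {z | window z s ζ.length = ζ} = ν {z | window z s ζ.length = ζ}) : μ = ν := by
  have hwin : ∀ (s : ℤ) (l : ℕ) (W : Set (List B)), μ {z | window z s l ∈ W} = ν {z | window z s l ∈ W} := by
    intro s l W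
    have : μ.map (fun z => window z s l) = ν.map (fun z => window z s l) := by
      refine Measure.ext_of_singleton fun ζ => ?_
      rw [Measure.map_apply (measurable_window s l) .of_discrete,
        Measure.map_apply (measurable_window s l) .of_discrete]
      by_cases hl : ζ.length = l
      · subst hl
        exact h s ζ
      · have : (fun z => window z s l) ⁻¹' ({ζ} : Set (List B)) = ∅ := by
          ext z
          simp only [Set.mem_preimage, Set.mem_singleton_iff, Set.mem_empty_iff_false, iff_false]
          rintro rfl
          simp at hl
        rw [this, measure_empty, measure_empty]
    have := DFunLike.congr_fun this W
    rwa [Measure.map_apply (measurable_window s l) .of_discrete,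
      Measure.map_apply (measurable_window s l) .of_discrete] at this
  let C : Set (Set (ℤ → B)) := {E | ∃ (n : ℕ) (W : Set (List B)), E = {z | window z (-n) (2 * n) ∈ W}}
  have hC : ∀ (n m : ℕ) (W : Set (List B)), n ≤ m → ∃ W' : Set (List B),
      {z | window z (-n) (2 * n) ∈ W} = {z | window z (-m) (2 * m) ∈ W'} := by
    intro n m W hnm
    refine ⟨{ζ | (ζ.drop (m - n)).take (2 * n) ∈ W}, ?_⟩
    ext z
    have h1 : window z (-m) (2 * m) = window z (-m) (m - n) ++
        (window z (-n) (2 * n) ++ window z n (m - n)) := by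
      have : 2 * m = (m - n) + (2 * n + (m - n)) := by omega
      conv_lhs => rw [this]
      rw [window_add, window_add]
      congr 2
      · congr 1
        omega
      · congr 1
        push_cast [hnm]
        ring
    simp only [Set.mem_ofPred_eq, h1]
    rw [List.drop_left' (by simp), List.take_left' (by simp)]
  refine ext_of_generate_finite C ?_ ?_ ?_ (by simp)
  · apply le_antisymm
    · rw [MeasurableSpace.pi]
      refine iSup_le fun i => ?_
      rintro _ ⟨t, ht, rfl⟩
      have : (fun z : ℤ → B => z i) ⁻¹' t =
          {z | window z (-(i.natAbs + 1 : ℕ)) (2 * (i.natAbs + 1)) ∈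
            {ζ | ∃ c ∈ t, ζ[(i + (i.natAbs + 1)).toNat]? = some c}} := by
        ext z
        have h1 : (i + (i.natAbs + 1)).toNat < 2 * (i.natAbs + 1) := by omega
        have h2 : -((i.natAbs + 1 : ℕ) : ℤ) + ((i + (i.natAbs + 1)).toNat : ℤ) = i := by omega
        simp only [Set.mem_preimage, Set.mem_ofPred_eq, window, List.getElem?_map,
          List.getElem?_range h1, Option.map_some, Option.some.injEq, h2]
        simp
      rw [this]
      exact MeasurableSpace.measurableSet_generateFrom ⟨_, _, rfl⟩
    · refine MeasurableSpace.generateFrom_le ?_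
      rintro _ ⟨n, W, rfl⟩
      exact measurable_window _ _ .of_discrete
  · rintro _ ⟨n, W, rfl⟩ _ ⟨m, V, rfl⟩ -
    obtain ⟨W', hW⟩ := hC n (max n m) W (le_max_left _ _)
    obtain ⟨V', hV⟩ := hC m (max n m) V (le_max_right _ _)
    rw [hW, hV]
    exact ⟨max n m, W' ∩ V', rfl⟩
  · rintro _ ⟨n, W, rfl⟩
    exact hwin _ _ _

theorem HasWindowLaw.apply {ν : Measure (ℤ → B)} {ρ : Measure B} (h : HasWindowLaw ν ρ) (s : ℤ)
    (l : ℕ) (W : Set (List B)) :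
    ν {z | window z s l ∈ W} = wordMeasure ρ {ζ | ζ ∈ W ∧ ζ.length = l} := by
  have h1 : ν.map (fun z => window z s l) = (wordMeasure ρ).restrict {ζ | ζ.length = l} := by
    refine Measure.ext_of_singleton fun ζ => ?_
    rw [Measure.map_apply (measurable_window s l) .of_discrete,
      Measure.restrict_apply .of_discrete]
    by_cases hl : ζ.length = l
    · subst hl
      rw [Set.inter_eq_left.2 (by simp)]
      exact h s ζ
    · have h2 : (fun z => window z s l) ⁻¹' ({ζ} : Set (List B)) = ∅ := by
        ext z
        simp only [Set.mem_preimage, Set.mem_singleton_iff, Set.mem_empty_iff_false, iff_false]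
        rintro rfl
        simp at hl
      rw [h2, measure_empty, Set.singleton_inter_eq_empty.2 (by simpa using hl), measure_empty]
  have := DFunLike.congr_fun h1 W
  rw [Measure.map_apply (measurable_window s l) .of_discrete,
    Measure.restrict_apply .of_discrete] at this
  exact this

theorem HasWindowLaw.map [MeasurableSpace A] [DiscreteMeasurableSpace A] [Countable A]
    {ν : Measure (ℤ → B)} {ρ : Measure B} (h : HasWindowLaw ν ρ)
    (g : B → A) : HasWindowLaw (ν.map fun z => g ∘ z) (ρ.map g) := by
  intro s w
  have hg : Measurable fun z : ℤ → B => g ∘ z :=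
    measurable_pi_iff.2 fun i => Measurable.of_discrete.comp (measurable_pi_apply i)
  refine (Measure.map_apply hg
    (measurable_window s _ (MeasurableSet.of_discrete (s := {w})))).trans ?_
  rw [← map_wordMeasure, Measure.map_apply .of_discrete .of_discrete]
  have := h.apply s w.length {ζ | ζ.map g = w}
  convert this using 2
  · ext z
    simp only [Set.mem_preimage, Set.mem_singleton_iff, Set.mem_ofPred_eq, map_window]
  · ext ζ
    simp only [Set.mem_preimage, Set.mem_singleton_iff, Set.mem_ofPred_eq]
    exact ⟨fun h => ⟨h, by simp [← h]⟩, fun h => h.1⟩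

theorem hasWindowLaw_of_cylinder {μ : Measure (ℤ → B)} [IsProbabilityMeasure μ] {ρ : Measure B}
    (h : ∀ (s : Finset ℤ) (f : ℤ → B), μ {x | ∀ i ∈ s, x i = f i} = ∏ i ∈ s, ρ {f i}) :
    HasWindowLaw μ ρ := by
  intro s w
  rcases w with _ | ⟨c, w⟩
  · simp [wordMeasure_nil, window]
  · obtain ⟨u, hu⟩ : ∃ u, u = c :: w := ⟨_, rfl⟩
    rw [← hu]
    have h1 := h ((Finset.range u.length).image fun n : ℕ => s + n)
      (fun i => u.getD (i - s).toNat c)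
    rw [Finset.prod_image (fun _ _ _ _ => by simp)] at h1
    simp only [Finset.mem_image, Finset.mem_range,
      forall_exists_index, and_imp, forall_apply_eq_imp_iff₂, add_sub_cancel_left,
      Int.toNat_natCast] at h1
    rw [wordMeasure_singleton]
    convert h1 using 1
    · congr 1
      ext z
      simp only [Set.mem_ofPred_eq, window_eq_iff]
      exact forall₂_congr fun i hi => by rw [List.getD_eq_getElem _ _ hi]
    · rw [← Fin.prod_univ_eq_prod_range (fun i => ρ {u.getD i c}), ← List.prod_ofFn]
      congr 1
      refine List.ext_getElem (by simp) fun i h2 h3 => ?_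
      simp only [List.length_map] at h2
      simp

theorem exists_hasWindowLaw (ρ : Measure B) [IsProbabilityMeasure ρ] :
    ∃ ν : Measure (ℤ → B), IsProbabilityMeasure ν ∧ HasWindowLaw ν ρ := by
  refine ⟨Measure.infinitePi fun _ => ρ, inferInstance, hasWindowLaw_of_cylinder fun s f => ?_⟩
  rw [← Measure.infinitePi_pi (μ := fun _ : ℤ => ρ) (fun _ _ => .of_discrete)]
  rfl

variable {ρ : Measure B} [IsProbabilityMeasure ρ] {ν : Measure (ℤ → B)} (hν : HasWindowLaw ν ρ)
  (π : B → A) (b : A) (k : ℕ)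

include hν in
theorem HasWindowLaw.measure_isCut_and_window (hb : ρ (π ⁻¹' {b})ᶜ ≠ 0) (s : ℤ) (ζ : List B) :
    ν {z | IsCut b k (π ∘ z) s ∧ window z s ζ.length = ζ} =
      cutProb ρ π b k * wordMeasure ρ {ζ} := by
  set X : Set (List B) := {ξ | IsMarkerBlock b 0 k (ξ.map π)} with hX
  have hlen : ∀ ξ ∈ X, ξ.length = k + 1 := by
    intro ξ hξ
    obtain ⟨n, -, hl, heq⟩ := isMarkerBlock_zero_iff.1 hξ
    simpa [hl] using congrArg List.length heq
  have h1 : {z | IsCut b k (π ∘ z) s ∧ window z s ζ.length = ζ} =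
      {z | window z (s - (k + 1)) (k + 1 + ζ.length) ∈ (· ++ ζ) '' X} := by
    ext z
    have hs : s - (k + 1) + ((k + 1 : ℕ) : ℤ) = s := by push_cast; ring
    rw [Set.mem_ofPred_eq, Set.mem_ofPred_eq, isCut_iff_isMarkerBlock,
      window_add z (s - (k + 1)) (k + 1) ζ.length, hs,
      ← map_window, Set.mem_image]
    constructor
    · rintro ⟨h1, h2⟩
      exact ⟨_, h1, by rw [h2]⟩
    · rintro ⟨ξ, hξ, heq⟩
      obtain ⟨rfl, h2⟩ := List.append_inj heq (by simp [hlen ξ hξ])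
      exact ⟨hξ, h2.symm⟩
  have h2 : {ξ | ξ ∈ (· ++ ζ) '' X ∧ ξ.length = k + 1 + ζ.length} = ⋃ ξ ∈ X, {ξ ++ ζ} := by
    ext ξ
    simp only [Set.mem_ofPred_eq, Set.mem_image, Set.mem_iUnion, Set.mem_singleton_iff]
    constructor
    · rintro ⟨⟨ξ', h1, rfl⟩, -⟩
      exact ⟨ξ', h1, rfl⟩
    · rintro ⟨ξ', h1, rfl⟩
      exact ⟨⟨ξ', h1, rfl⟩, by simp [hlen _ h1]⟩
  have h3 : wordMeasure ρ X = cutProb ρ π b k := by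
    rw [cutProb, ← blockMeasure_univ ρ π b 0 k hb, blockMeasure, Measure.restrict_apply_univ]
  rw [h1, hν.apply, h2, measure_biUnion X.to_countable _ fun _ _ => .of_discrete, ← h3]
  · simp only [wordMeasure_append]
    rw [ENNReal.tsum_mul_right]
    congr 1
    rw [← measure_biUnion X.to_countable (f := fun ξ => {ξ}) _ fun _ _ => .of_discrete]
    · simp
    · exact fun x _ y _ hxy => by simpa using hxy
  · exact fun x _ y _ hxy => by simpa using hxy

/-- The event that `ζ` is a level `k` block with index `j` starting `i` letters before `p`. -/
def blockEvent (p : ℤ) (G : ℕ → ℕ → List B → Prop) (t : ℕ × List B × ℕ) : Set (ℤ → B) :=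
  {z | (t.2.2 < t.2.1.length ∧ IsMarkerBlock b k t.1 (t.2.1.map π) ∧ G t.2.2 t.1 t.2.1) ∧
    IsCut b k (π ∘ z) (p - t.2.2) ∧ window z (p - t.2.2) t.2.1.length = t.2.1}

omit [MeasurableSpace B] [DiscreteMeasurableSpace B] [Countable B] in
theorem setOf_exists_block_eq (p : ℤ) (G : ℕ → ℕ → List B → Prop) :
    {z | ∃ i j l : ℕ, i < l ∧ IsBlockAt b k j (π ∘ z) (p - i) l ∧ G i j (window z (p - i) l)} =
      ⋃ t, blockEvent π b k p G t := by
  ext z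
  simp only [Set.mem_ofPred_eq, Set.mem_iUnion, blockEvent, Prod.exists]
  constructor
  · rintro ⟨i, j, l, hi, h1, h2⟩
    exact ⟨j, window z (p - i) l, i, ⟨by simpa using hi, by simpa [map_window] using h1.2, h2⟩,
      h1.1, by simp⟩
  · rintro ⟨j, ζ, i, ⟨hi, h1, h2⟩, h3, h4⟩
    exact ⟨i, j, ζ.length, hi, ⟨h3, by rwa [← map_window, h4]⟩, by rwa [h4]⟩

theorem measurableSet_blockEvent (p : ℤ) (G : ℕ → ℕ → List B → Prop) (t : ℕ × List B × ℕ) :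
    MeasurableSet (blockEvent π b k p G t) := by
  have h1 : {z : ℤ → B | IsCut b k (π ∘ z) (p - t.2.2)} =
      (fun z => window z (p - t.2.2 - (k + 1)) (k + 1)) ⁻¹'
        {ξ | IsMarkerBlock b 0 k (ξ.map π)} := by
    ext z
    simp only [isCut_iff_isMarkerBlock, map_window, Set.mem_preimage, Set.mem_ofPred_eq]
  have hm1 : MeasurableSet {z : ℤ → B | IsCut b k (π ∘ z) (p - t.2.2)} := by
    rw [h1]
    exact measurable_window _ _ .of_discrete
  have hm2 : MeasurableSet {z : ℤ → B | window z (p - t.2.2) t.2.1.length = t.2.1} :=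
    measurable_window _ _ (MeasurableSet.of_discrete (s := {t.2.1}))
  exact (MeasurableSet.const _).inter (hm1.inter hm2)

theorem measurableSet_exists_block (p : ℤ) (G : ℕ → ℕ → List B → Prop) :
    MeasurableSet {z | ∃ i j l : ℕ, i < l ∧ IsBlockAt b k j (π ∘ z) (p - i) l ∧
      G i j (window z (p - i) l)} := by
  rw [setOf_exists_block_eq]
  exact .iUnion (measurableSet_blockEvent π b k p G)

include hν in
open Classical in
/-- The probability that the block covering a given position has some property is its density
times the mean number of positions in blocks at which the property holds. -/
theorem HasWindowLaw.measure_exists_block (hb : ρ (π ⁻¹' {b})ᶜ ≠ 0) (p : ℤ)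
    (G : ℕ → ℕ → List B → Prop) :
    ν {z | ∃ i j l : ℕ, i < l ∧ IsBlockAt b k j (π ∘ z) (p - i) l ∧ G i j (window z (p - i) l)} =
      cutProb ρ π b k * ∑' j, ∫⁻ ζ,
        (∑ i ∈ Finset.range ζ.length, if G i j ζ then 1 else 0) ∂blockMeasure ρ π b k j := by
  have hdisj : Pairwise (Function.onFun Disjoint (blockEvent π b k p G)) := by
    rintro ⟨j, ζ, i⟩ ⟨j', ζ', i'⟩ hne
    refine Set.disjoint_left.2 ?_
    rintro z ⟨⟨h1, h2, -⟩, h3, h4⟩ ⟨⟨h1', h2', -⟩, h3', h4'⟩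
    apply hne
    dsimp only at *
    obtain ⟨hs, hl, rfl⟩ := IsBlockAt.unique (p := p) (l := ζ.length) (l' := ζ'.length)
      ⟨h3, by rwa [← map_window, h4]⟩ ⟨h3', by rwa [← map_window, h4']⟩ (by omega) (by omega)
      (by omega) (by omega)
    obtain rfl : i = i' := by omega
    rw [← h4, ← h4', hl]
  rw [setOf_exists_block_eq, measure_iUnion hdisj (measurableSet_blockEvent π b k p G),
    ENNReal.tsum_prod', ← ENNReal.tsum_mul_left]
  refine tsum_congr fun j => ?_
  rw [ENNReal.tsum_prod', lintegral_countable', ← ENNReal.tsum_mul_left]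
  refine tsum_congr fun ζ => ?_
  rw [tsum_eq_sum (s := Finset.range ζ.length), Finset.sum_mul, Finset.mul_sum]
  · refine Finset.sum_congr rfl fun i hi => ?_
    by_cases hζ : IsMarkerBlock b k j (ζ.map π)
    · by_cases hG : G i j ζ
      · simp only [blockEvent, List.mem_range.1 (by simpa using hi), hζ, hG, and_self, true_and,
          if_true, one_mul, blockMeasure_singleton ρ π b hζ]
        exact hν.measure_isCut_and_window π b k hb _ _
      · simp [blockEvent, hG]
    · simp [blockEvent, hζ, blockMeasure_singleton_of_not ρ π b hζ]
  · intro i hi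
    have : ¬ i < ζ.length := by simpa using hi
    simp [blockEvent, this]

include hν in
theorem HasWindowLaw.ae_exists_block [IsProbabilityMeasure ν] (hb : ρ (π ⁻¹' {b})ᶜ ≠ 0)
    (hb' : ρ (π ⁻¹' {b}) ≠ 0) (p : ℤ) :
    ∀ᵐ z ∂ν, ∃ i j l : ℕ, i < l ∧ IsBlockAt b k j (π ∘ z) (p - i) l := by
  have h := hν.measure_exists_block π b k hb p fun _ _ _ => True
  have hm := measurableSet_exists_block π b k p fun _ _ (_ : List B) => True
  simp only [and_true, if_true, Finset.sum_const, Finset.card_range, nsmul_eq_mul, mul_one] at h hm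
  rw [ae_iff_measure_eq hm.nullMeasurableSet, measure_univ]
  refine le_antisymm prob_le_one ?_
  rw [h]
  exact one_le_cutProb_mul_tsum_lintegral_length ρ π b k hb hb'

end WindowLaw

section WordCoupling

variable {A : Type*}

/-- The word of pairs with given coordinates. -/
def pairWord {l : ℕ} (x y : Fin l → A) : List (A × A) := List.ofFn fun i => (x i, y i)

theorem map_fst_pairWord {l : ℕ} (x y : Fin l → A) :
    (pairWord x y).map Prod.fst = List.ofFn x := by
  simp [pairWord, List.map_ofFn, Function.comp_def]

theorem map_snd_pairWord {l : ℕ} (x y : Fin l → A) :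
    (pairWord x y).map Prod.snd = List.ofFn y := by
  simp [pairWord, List.map_ofFn, Function.comp_def]

theorem length_pairWord {l : ℕ} (x y : Fin l → A) : (pairWord x y).length = l := by
  simp [pairWord]

theorem zip_ofFn {l : ℕ} (x y : Fin l → A) : (List.ofFn x).zip (List.ofFn y) = pairWord x y :=
  List.ext_getElem (by simp [pairWord]) fun i h1 h2 => by simp [pairWord]

theorem pairWord_inj {l : ℕ} {x y x' y' : Fin l → A} :
    pairWord x y = pairWord x' y' ↔ x = x' ∧ y = y' := by
  refine ⟨fun h => ⟨?_, ?_⟩, fun h => by rw [h.1, h.2]⟩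
  · exact List.ofFn_injective (by rw [← map_fst_pairWord x y, h, map_fst_pairWord])
  · exact List.ofFn_injective (by rw [← map_snd_pairWord x y, h, map_snd_pairWord])

theorem exists_eq_pairWord (ζ : List (A × A)) :
    ∃ x y : Fin ζ.length → A, ζ = pairWord x y :=
  ⟨fun i => (ζ.get i).1, fun i => (ζ.get i).2, (List.ofFn_get ζ).symm⟩

theorem tsum_pairWord [Fintype A] (F : List (A × A) → ℝ≥0∞) :
    ∑' ζ, F ζ = ∑' l, ∑ x : Fin l → A, ∑ y : Fin l → A, F (pairWord x y) := by
  rw [← List.equivSigmaTuple.symm.tsum_eq F, ENNReal.tsum_sigma']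
  refine tsum_congr fun l => ?_
  rw [← (Equiv.arrowProdEquivProdArrow (Fin l) (fun _ => A) (fun _ => A)).symm.tsum_eq,
    tsum_fintype, Fintype.sum_prod_type]
  rfl

variable [Fintype A] (κ : Measure (List (A × A)))

theorem measure_map_fst_eq {l : ℕ} (x : Fin l → A) :
    κ {ζ | ζ.map Prod.fst = List.ofFn x} = ∑ y : Fin l → A, κ {pairWord x y} := by
  have : {ζ | ζ.map Prod.fst = List.ofFn x} = ⋃ y ∈ (Finset.univ : Finset (Fin l → A)),
      {pairWord x y} := by
    ext ζ
    simp only [Set.mem_ofPred_eq, Set.mem_iUnion, Set.mem_singleton_iff, Finset.mem_univ,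
      exists_prop, true_and]
    constructor
    · intro h
      obtain ⟨x', y', h'⟩ := exists_eq_pairWord ζ
      have hl : ζ.length = l := by simpa using congrArg List.length h
      subst hl
      have h2 := List.ofFn_injective
        ((map_fst_pairWord x' y').symm.trans ((congrArg _ h').symm.trans h))
      exact ⟨y', by rw [← h2]; exact h'⟩
    · rintro ⟨y, rfl⟩
      exact map_fst_pairWord x y
  rw [this, measure_biUnion_finset _ fun _ _ => .of_discrete]
  intro y _ y' _ hne
  simpa [pairWord_inj] using hne

theorem measure_map_snd_eq {l : ℕ} (y : Fin l → A) :
    κ {ζ | ζ.map Prod.snd = List.ofFn y} = ∑ x : Fin l → A, κ {pairWord x y} := by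
  have : {ζ | ζ.map Prod.snd = List.ofFn y} = ⋃ x ∈ (Finset.univ : Finset (Fin l → A)),
      {pairWord x y} := by
    ext ζ
    simp only [Set.mem_ofPred_eq, Set.mem_iUnion, Set.mem_singleton_iff, Finset.mem_univ,
      exists_prop, true_and]
    constructor
    · intro h
      obtain ⟨x', y', h'⟩ := exists_eq_pairWord ζ
      have hl : ζ.length = l := by simpa using congrArg List.length h
      subst hl
      have h2 := List.ofFn_injective
        ((map_snd_pairWord x' y').symm.trans ((congrArg _ h').symm.trans h))
      exact ⟨x', by rw [← h2]; exact h'⟩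
    · rintro ⟨x, rfl⟩
      exact map_snd_pairWord x y
  rw [this, measure_biUnion_finset _ fun _ _ => .of_discrete]
  intro y _ y' _ hne
  simpa [pairWord_inj] using hne

theorem exists_measure_pairWord (r : ∀ l : ℕ, (Fin l → A) → (Fin l → A) → ℝ) :
    ∃ κ : Measure (List (A × A)), ∀ (l : ℕ) (x y : Fin l → A),
      κ {pairWord x y} = ENNReal.ofReal (r l x y) := by
  refine ⟨Measure.sum fun ζ => ENNReal.ofReal
    ((fun s : Σ n, Fin n → A × A => r s.1 (fun i => (s.2 i).1) (fun i => (s.2 i).2))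
      (List.equivSigmaTuple ζ)) • Measure.dirac ζ, fun l x y => ?_⟩
  rw [Measure.sum_smul_dirac_singleton, show pairWord x y =
    List.equivSigmaTuple.symm ⟨l, fun i => (x i, y i)⟩ from rfl, Equiv.apply_symm_apply]

theorem lintegral_pairWord (F : List (A × A) → ℝ≥0∞) :
    ∫⁻ ζ, F ζ ∂κ = ∑' l, ∑ x : Fin l → A, ∑ y : Fin l → A,
      F (pairWord x y) * κ {pairWord x y} := by
  rw [lintegral_countable', tsum_pairWord]

/-- A coupling of words can be replaced by another one with the same marginals and smaller cost
for which the second word is mostly a function of the first one. -/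
theorem exists_word_coupling [DecidableEq A] (a₀ : A) (p q : A → ℝ) (hp : ∀ a, 0 ≤ p a)
    (hq : ∀ a, 0 ≤ q a) (η : ℕ → ℝ)
    (hη : ∀ l, ∃ S : Finset (Fin l → A), ∃ θ : ℝ, 0 ≤ θ ∧
        ∑ v, (if v ∈ S then 0 else ∏ i, q (v i)) +
          ∑ w : Fin l → A, (if θ < ∏ i, p (w i) then ∏ i, p (w i) else 0) + S.card * θ ≤ η l)
    (hRp : ∀ w : List A, κ {ζ | ζ.map Prod.fst = w} ≤ ENNReal.ofReal (w.map p).prod)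
    (hRq : ∀ w : List A, κ {ζ | ζ.map Prod.snd = w} ≤ ENNReal.ofReal (w.map q).prod)
    (c : List (A × A) → ℕ) :
    ∃ (κ' : Measure (List (A × A))) (f : List A → List A),
      κ'.map (List.map Prod.fst) = κ.map (List.map Prod.fst) ∧
      κ'.map (List.map Prod.snd) = κ.map (List.map Prod.snd) ∧
      (∀ ζ, κ {ζ} = 0 → κ' {ζ} = 0) ∧
      (∫⁻ ζ, c ζ ∂κ') ≤ ∫⁻ ζ, c ζ ∂κ ∧
      (∀ w, (f w).length = w.length) ∧
      (∀ w, f w = List.replicate w.length a₀ ∨ κ {w.zip (f w)} ≠ 0) ∧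
      ∀ l, κ' {ζ | ζ.length = l ∧ ζ.map Prod.snd ≠ f (ζ.map Prod.fst)} ≤ ENNReal.ofReal (η l) := by
  have hfin : ∀ {l : ℕ} (x y : Fin l → A), κ {pairWord x y} ≠ ∞ := by
    intro l x y
    refine ne_top_of_le_ne_top ?_ ((measure_mono ?_).trans (hRp (List.ofFn x)))
    · exact ENNReal.ofReal_ne_top
    · simp [map_fst_pairWord]
  have key : ∀ l : ℕ, ∃ r' : (Fin l → A) → (Fin l → A) → ℝ, ∃ f : (Fin l → A) → (Fin l → A),
      (∀ x y, 0 ≤ r' x y) ∧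
      (∀ x, ∑ y, ENNReal.ofReal (r' x y) = ∑ y, κ {pairWord x y}) ∧
      (∀ y, ∑ x, ENNReal.ofReal (r' x y) = ∑ x, κ {pairWord x y}) ∧
      (∀ x y, κ {pairWord x y} = 0 → r' x y = 0) ∧
      (∑ x : Fin l → A, ∑ y : Fin l → A, (c (pairWord x y) : ℝ≥0∞) * ENNReal.ofReal (r' x y) ≤
        ∑ x : Fin l → A, ∑ y : Fin l → A, (c (pairWord x y) : ℝ≥0∞) * κ {pairWord x y}) ∧
      (∀ x, f x = (fun _ => a₀) ∨ κ {pairWord x (f x)} ≠ 0) ∧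
      ∑ x : Fin l → A, ∑ y : Fin l → A, (if y = f x then 0 else ENNReal.ofReal (r' x y)) ≤
        ENNReal.ofReal (η l) := by
    intro l
    obtain ⟨S, θ, hθ, hS⟩ := hη l
    let r : (Fin l → A) → (Fin l → A) → ℝ := fun x y => (κ {pairWord x y}).toReal
    have hr : ∀ x y, κ {pairWord x y} = ENNReal.ofReal (r x y) := fun x y =>
      (ENNReal.ofReal_toReal (hfin x y)).symm
    have hr0 : ∀ x y, 0 ≤ r x y := fun _ _ => ENNReal.toReal_nonneg
    obtain ⟨r', f, h0, h1, h2, h3, h4, h5, h6⟩ := exists_almost_deterministic_coupling r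
      (fun x y => (c (pairWord x y) : ℝ)) hr0 (fun _ _ => a₀) S hθ
    refine ⟨r', f, h0, fun x => ?_, fun y => ?_, fun x y h => h3 x y (by simp [r, h]), ?_,
      fun x => (h5 x).imp_right fun h h' => h (by simp [r, h']), ?_⟩
    · simp only [hr, ← ENNReal.ofReal_sum_of_nonneg fun y _ => h0 x y,
        ← ENNReal.ofReal_sum_of_nonneg fun y _ => hr0 x y, h1]
    · simp only [hr, ← ENNReal.ofReal_sum_of_nonneg fun x _ => h0 x y,
        ← ENNReal.ofReal_sum_of_nonneg fun x _ => hr0 x y, h2]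
    · have : ∀ s : (Fin l → A) → (Fin l → A) → ℝ, (∀ x y, 0 ≤ s x y) →
          ∑ x, ∑ y, (c (pairWord x y) : ℝ≥0∞) * ENNReal.ofReal (s x y) =
            ENNReal.ofReal (∑ x, ∑ y, (c (pairWord x y) : ℝ) * s x y) := by
        intro s hs
        rw [ENNReal.ofReal_sum_of_nonneg fun x _ => Finset.sum_nonneg fun y _ =>
          mul_nonneg (Nat.cast_nonneg _) (hs x y)]
        refine Finset.sum_congr rfl fun x _ => ?_
        rw [ENNReal.ofReal_sum_of_nonneg fun y _ => mul_nonneg (Nat.cast_nonneg _) (hs x y)]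
        refine Finset.sum_congr rfl fun y _ => ?_
        rw [ENNReal.ofReal_mul (Nat.cast_nonneg _), ENNReal.ofReal_natCast]
      simp only [hr]
      rw [this r' h0, this r hr0]
      exact ENNReal.ofReal_le_ofReal h4
    · have h7 : ∑ x, ∑ y, (if y = f x then 0 else ENNReal.ofReal (r' x y)) =
          ENNReal.ofReal (∑ x, ∑ y, (if y = f x then 0 else r' x y)) := by
        have h8 : ∀ x y, 0 ≤ if y = f x then 0 else r' x y := fun x y => by
          split_ifs
          · rfl
          · exact h0 x y
        rw [ENNReal.ofReal_sum_of_nonneg fun x _ => Finset.sum_nonneg fun y _ => h8 x y]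
        refine Finset.sum_congr rfl fun x _ => ?_
        rw [ENNReal.ofReal_sum_of_nonneg fun y _ => h8 x y]
        refine Finset.sum_congr rfl fun y _ => ?_
        split_ifs <;> simp
      have hprod : ∀ (g : A → ℝ) (x : Fin l → A), ((List.ofFn x).map g).prod = ∏ i, g (x i) := by
        intro g x
        rw [List.map_ofFn, List.prod_ofFn]
        rfl
      have hrow : ∀ x, ∑ y, r x y ≤ ∏ i, p (x i) := by
        intro x
        rw [← hprod, ← ENNReal.ofReal_le_ofReal_iff (by
            rw [hprod]; exact Finset.prod_nonneg fun i _ => hp _),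
          ENNReal.ofReal_sum_of_nonneg fun y _ => hr0 x y]
        simp only [← hr]
        rw [← measure_map_fst_eq]
        exact hRp _
      have hcol : ∀ y, ∑ x, r x y ≤ ∏ i, q (y i) := by
        intro y
        rw [← hprod, ← ENNReal.ofReal_le_ofReal_iff (by
            rw [hprod]; exact Finset.prod_nonneg fun i _ => hq _),
          ENNReal.ofReal_sum_of_nonneg fun x _ => hr0 x y]
        simp only [← hr]
        rw [← measure_map_snd_eq]
        exact hRq _
      rw [h7]
      refine ENNReal.ofReal_le_ofReal (h6.trans (le_trans ?_ hS))
      gcongr with y _ x _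
      · split_ifs
        · rfl
        · exact hcol y
      · have := hrow x
        split_ifs with h9 h10 h10
        · exact this
        · linarith
        · exact Finset.prod_nonneg fun i _ => hp _
        · rfl
  choose r' f h0 h1 h2 h3 h4 h5 h6 using key
  obtain ⟨κ', hκ'⟩ := exists_measure_pairWord r'
  have hf : ∃ f' : List A → List A, ∀ (l : ℕ) (x : Fin l → A),
      f' (List.ofFn x) = List.ofFn (f l x) := by
    refine ⟨fun w => (fun s : Σ n, Fin n → A => List.ofFn (f s.1 s.2)) (List.equivSigmaTuple w),
      fun l x => ?_⟩
    exact congrArg (fun s : Σ n, Fin n → A => List.ofFn (f s.1 s.2))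
      (List.equivSigmaTuple.apply_symm_apply ⟨l, x⟩)
  obtain ⟨f', hf'⟩ := hf
  refine ⟨κ', f', ?_, ?_, ?_, ?_, ?_, ?_, ?_⟩
  · refine Measure.ext_of_singleton fun w => ?_
    rw [Measure.map_apply .of_discrete .of_discrete, Measure.map_apply .of_discrete .of_discrete]
    obtain ⟨l, x, rfl⟩ : ∃ l, ∃ x : Fin l → A, w = List.ofFn x :=
      ⟨w.length, w.get, (List.ofFn_get w).symm⟩
    have e1 := measure_map_fst_eq κ' x
    have e2 := measure_map_fst_eq κ x
    simp only [hκ', h1, ← e2] at e1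
    exact e1
  · refine Measure.ext_of_singleton fun w => ?_
    rw [Measure.map_apply .of_discrete .of_discrete, Measure.map_apply .of_discrete .of_discrete]
    obtain ⟨l, x, rfl⟩ : ∃ l, ∃ x : Fin l → A, w = List.ofFn x :=
      ⟨w.length, w.get, (List.ofFn_get w).symm⟩
    have e1 := measure_map_snd_eq κ' x
    have e2 := measure_map_snd_eq κ x
    simp only [hκ', h2, ← e2] at e1
    exact e1
  · intro ζ hζ
    obtain ⟨x, y, h⟩ := exists_eq_pairWord ζ
    rw [h] at hζ ⊢
    rw [hκ', h3 _ x y hζ, ENNReal.ofReal_zero]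
  · rw [lintegral_pairWord, lintegral_pairWord]
    simp only [hκ']
    exact ENNReal.tsum_le_tsum h4
  · intro w
    obtain ⟨l, x, rfl⟩ : ∃ l, ∃ x : Fin l → A, w = List.ofFn x :=
      ⟨w.length, w.get, (List.ofFn_get w).symm⟩
    simp [hf']
  · intro w
    obtain ⟨l, x, rfl⟩ : ∃ l, ∃ x : Fin l → A, w = List.ofFn x :=
      ⟨w.length, w.get, (List.ofFn_get w).symm⟩
    rw [hf', zip_ofFn]
    refine (h5 l x).imp_left fun h => ?_
    rw [h, List.ofFn_const, List.length_ofFn]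
  · intro l
    rw [← lintegral_indicator_one .of_discrete, lintegral_pairWord]
    refine le_trans (le_of_eq ?_) (h6 l)
    rw [tsum_eq_single l]
    · refine Finset.sum_congr rfl fun x _ => Finset.sum_congr rfl fun y _ => ?_
      rw [Set.indicator_apply]
      simp only [Set.mem_ofPred_eq, length_pairWord, map_snd_pairWord, map_fst_pairWord, hf',
        true_and, hκ']
      split_ifs <;> simp_all
    · intro l' hl'
      refine Finset.sum_eq_zero fun x _ => Finset.sum_eq_zero fun y _ => ?_
      rw [Set.indicator_of_notMem (by simp [length_pairWord, hl']), zero_mul]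

end WordCoupling

section Hamming

variable {A : Type*} [DecidableEq A] [Bot A]

/-- The number of places where two words of the same length differ. -/
def hammingCount (u v : List A) : ℕ :=
  ∑ i ∈ Finset.range u.length, if u.getD i ⊥ = v.getD i ⊥ then 0 else 1

theorem hammingCount_append {u v u' v' : List A} (h : u.length = u'.length) :
    hammingCount (u ++ v) (u' ++ v') = hammingCount u u' + hammingCount v v' := by
  rw [hammingCount, List.length_append, Finset.sum_range_add]
  congr 1
  · refine Finset.sum_congr rfl fun i hi => ?_
    have hi := Finset.mem_range.1 hi
    rw [List.getD_append _ _ _ _ hi, List.getD_append _ _ _ _ (h ▸ hi)]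
  · refine Finset.sum_congr rfl fun i hi => ?_
    rw [List.getD_append_right _ _ _ _ (by omega), List.getD_append_right _ _ _ _ (by omega), ← h,
      Nat.add_sub_cancel_left]

theorem hammingCount_triangle {u v w : List A} (h : u.length = v.length) :
    hammingCount u w ≤ hammingCount u v + hammingCount v w := by
  rw [hammingCount, hammingCount, hammingCount, ← h, ← Finset.sum_add_distrib]
  refine Finset.sum_le_sum fun i _ => ?_
  split_ifs <;> simp_all

theorem hammingCount_le (u v : List A) : hammingCount u v ≤ if v = u then 0 else u.length := by
  split_ifs with h
  · simp [hammingCount, h]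
  · exact (Finset.sum_le_card_nsmul _ _ 1 fun i _ => by split_ifs <;> simp).trans (by simp)

end Hamming

section Parse

variable {A : Type*} (f : ℕ → List A → List A) (b : A) (k j : ℕ)

/-- The word obtained from a block of level `k + 1` by applying `f` to the blocks of level `k` it is
made of. -/
inductive IsParse : List A → List A → Prop
  | base {w : List A} (hw : IsMarkerBlock b k (j + 1) w) : IsParse w (f (j + 1) w)
  | cons {u w g : List A} (hu : IsMarkerBlock b k 0 u) (hw : IsParse w g) :
      IsParse (u ++ w) (f 0 u ++ g)

variable {f b k j}

theorem isParse_iff {w g : List A} : IsParse f b k j w g ↔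
    (IsMarkerBlock b k (j + 1) w ∧ g = f (j + 1) w) ∨
      ∃ u v g', IsMarkerBlock b k 0 u ∧ IsParse f b k j v g' ∧ w = u ++ v ∧ g = f 0 u ++ g' := by
  constructor
  · rintro (hw | ⟨hu, hw⟩)
    · exact .inl ⟨hw, rfl⟩
    · exact .inr ⟨_, _, _, hu, hw, rfl, rfl⟩
  · rintro (⟨h, rfl⟩ | ⟨u, v, g', hu, hv, rfl, rfl⟩)
    · exact .base h
    · exact .cons hu hv

theorem IsParse.unique {w g g' : List A} (h : IsParse f b k j w g) (h' : IsParse f b k j w g') :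
    g = g' := by
  induction h generalizing g' with
  | base hw =>
    rcases isParse_iff.1 h' with ⟨-, rfl⟩ | ⟨u, v, g', hu, -, rfl, -⟩
    · rfl
    · have := (hw.append_inj hu (List.append_nil _)).2.2
      omega
  | cons hu hw ih =>
    rcases isParse_iff.1 h' with ⟨hw', -⟩ | ⟨u, v, g'', hu', hv', heq, rfl⟩
    · have := (hw'.append_inj hu (List.append_nil _)).2.2
      omega
    · obtain ⟨rfl, rfl, -⟩ := hu.append_inj hu' heq
      rw [ih hv']

theorem IsMarkerBlock.exists_isParse {w : List A} (h : IsMarkerBlock b (k + 1) j w) :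
    ∃ g, IsParse f b k j w g := by
  generalize hK : k + 1 = K at h
  induction h with
  | base => omega
  | lift hw =>
    cases hK
    exact ⟨_, .base hw⟩
  | cons hu hw ih1 ih2 =>
    cases hK
    obtain ⟨g, hg⟩ := ih2 rfl
    exact ⟨_, .cons hu hg⟩

theorem IsParse.length_eq {w g : List A} (hf : ∀ j w, (f j w).length = w.length)
    (h : IsParse f b k j w g) : g.length = w.length := by
  induction h with
  | base hw => exact hf _ _
  | cons hu hw ih => simp [hf, ih]

variable (f b k j)

open Classical in
/-- The value of `IsParse` as a function. -/
noncomputable def parse (w : List A) : List A :=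
  if h : ∃ g, IsParse f b k j w g then h.choose else w

variable {f b k j}

theorem IsParse.parse_eq {w g : List A} (h : IsParse f b k j w g) : parse f b k j w = g := by
  have hex : ∃ g, IsParse f b k j w g := ⟨g, h⟩
  rw [parse, dif_pos hex]
  exact hex.choose_spec.unique h

theorem length_parse (hf : ∀ j w, (f j w).length = w.length) (w : List A) :
    (parse f b k j w).length = w.length := by
  rw [parse]
  split_ifs with h
  · exact h.choose_spec.length_eq hf
  · rfl

theorem parse_of_isMarkerBlock {w : List A} (h : IsMarkerBlock b k (j + 1) w) :
    parse f b k j w = f (j + 1) w :=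
  (IsParse.base h).parse_eq

theorem parse_append {u w : List A} (hu : IsMarkerBlock b k 0 u)
    (hw : IsMarkerBlock b (k + 1) j w) :
    parse f b k j (u ++ w) = f 0 u ++ parse f b k j w := by
  obtain ⟨g, hg⟩ := hw.exists_isParse (f := f)
  rw [hg.parse_eq, (hg.cons hu).parse_eq]

end Parse

section Stage

variable {A : Type*} [Fintype A] [LinearOrder A] [OrderBot A] [MeasurableSpace A]
  [DiscreteMeasurableSpace A] (ρ : Measure (A × A)) (b : A)

/-- A stage of the construction of the factor map: `κ j` is a coupling of the laws of the two
coordinates of a block of level `k` and excess `j`, and `f j` is a map which, for the later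
stages, mostly gives the second coordinate as a function of the first one. -/
structure IsStage (k : ℕ) (κ : ℕ → Measure (List (A × A))) (f : ℕ → List A → List A) : Prop where
  map_fst : ∀ j, (κ j).map (List.map Prod.fst) =
    (blockMeasure ρ Prod.fst b k j).map (List.map Prod.fst)
  map_snd : ∀ j, (κ j).map (List.map Prod.snd) =
    (blockMeasure ρ Prod.fst b k j).map (List.map Prod.snd)
  ae_le : ∀ j, ∀ᵐ ζ ∂κ j, ∀ c ∈ ζ, c.2 ≤ c.1
  length_eq : ∀ j w, (f j w).length = w.length
  getD_le : ∀ j w i, (f j w).getD i ⊥ ≤ w.getD i ⊥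

variable {ρ b} {k : ℕ} {κ : ℕ → Measure (List (A × A))} {f : ℕ → List A → List A}

theorem isStage_zero (hρ : ∀ᵐ c ∂ρ, c.2 ≤ c.1) :
    IsStage ρ b 0 (blockMeasure ρ Prod.fst b 0) (fun _ w => List.replicate w.length ⊥) where
  map_fst _ := rfl
  map_snd _ := rfl
  ae_le j := by
    have h : ∀ᵐ ζ ∂wordMeasure ρ, ∀ c ∈ ζ, c.2 ≤ c.1 := ae_wordMeasure hρ
    exact (Measure.absolutelyContinuous_of_le (blockMeasure_le ρ Prod.fst b 0 j)).ae_le h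
  length_eq := by simp
  getD_le j w i := by
    rcases lt_or_ge i w.length with h | h
    · simp [h]
    · simp [h]

omit [Fintype A] [DiscreteMeasurableSpace A] in
theorem IsStage.lintegral_fst (h : IsStage ρ b k κ f) (j : ℕ) (F : List A → ℝ≥0∞) :
    ∫⁻ ζ, F (ζ.map Prod.fst) ∂κ j = ∫⁻ ζ, F (ζ.map Prod.fst) ∂blockMeasure ρ Prod.fst b k j := by
  rw [← lintegral_map (f := F) .of_discrete .of_discrete, h.map_fst,
    lintegral_map .of_discrete .of_discrete]

omit [Fintype A] [DiscreteMeasurableSpace A] in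
theorem IsStage.lintegral_snd (h : IsStage ρ b k κ f) (j : ℕ) (F : List A → ℝ≥0∞) :
    ∫⁻ ζ, F (ζ.map Prod.snd) ∂κ j = ∫⁻ ζ, F (ζ.map Prod.snd) ∂blockMeasure ρ Prod.fst b k j := by
  rw [← lintegral_map (f := F) .of_discrete .of_discrete, h.map_snd,
    lintegral_map .of_discrete .of_discrete]

omit [Fintype A] [DiscreteMeasurableSpace A] in
theorem IsStage.measure_univ (h : IsStage ρ b k κ f) (j : ℕ) :
    κ j Set.univ = blockMeasure ρ Prod.fst b k j Set.univ := by
  simpa using h.lintegral_fst j fun _ => 1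

omit [Fintype A] [DiscreteMeasurableSpace A] in
theorem IsStage.ae_isMarkerBlock (h : IsStage ρ b k κ f) (j : ℕ) :
    ∀ᵐ ζ ∂κ j, IsMarkerBlock b k j (ζ.map Prod.fst) := by
  have h1 : ∀ᵐ w ∂(κ j).map (List.map Prod.fst), IsMarkerBlock b k j w := by
    rw [h.map_fst, ae_map_iff Measurable.of_discrete.aemeasurable .of_discrete]
    exact ae_blockMeasure ρ Prod.fst b k j
  exact (ae_map_iff Measurable.of_discrete.aemeasurable .of_discrete).1 h1

/-- Couplings of blocks of level `k` give couplings of blocks of level `k + 1`. -/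
theorem IsStage.map_renewalMeasure_fst (h : IsStage ρ b k κ f) (j : ℕ) :
    (renewalMeasure (κ 0) (κ (j + 1))).map (List.map Prod.fst) =
      (blockMeasure ρ Prod.fst b (k + 1) j).map (List.map Prod.fst) := by
  rw [blockMeasure_succ, map_renewalMeasure, map_renewalMeasure, h.map_fst, h.map_fst]

theorem IsStage.map_renewalMeasure_snd (h : IsStage ρ b k κ f) (j : ℕ) :
    (renewalMeasure (κ 0) (κ (j + 1))).map (List.map Prod.snd) =
      (blockMeasure ρ Prod.fst b (k + 1) j).map (List.map Prod.snd) := by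
  rw [blockMeasure_succ, map_renewalMeasure, map_renewalMeasure, h.map_snd, h.map_snd]

/-- The mean number of places where the stage fails to give the second coordinate does not
depend on the level at which it is computed. -/
theorem IsStage.mul_tsum_lintegral_parse [IsProbabilityMeasure ρ] (h : IsStage ρ b k κ f)
    (hb : ρ (Prod.fst ⁻¹' {b})ᶜ ≠ 0) (hb' : ρ (Prod.fst ⁻¹' {b}) ≠ 0) :
    ρ (Prod.fst ⁻¹' {b})ᶜ * ∑' j, ∫⁻ ζ,
        (hammingCount (parse f b k j (ζ.map Prod.fst)) (ζ.map Prod.snd) : ℝ≥0∞)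
          ∂renewalMeasure (κ 0) (κ (j + 1)) =
      ∑' j, ∫⁻ ζ, (hammingCount (f j (ζ.map Prod.fst)) (ζ.map Prod.snd) : ℝ≥0∞) ∂κ j := by
  set γ := ρ (Prod.fst ⁻¹' {b})ᶜ with hγ
  set β := ρ (Prod.fst ⁻¹' {b}) with hβ
  have hβγ : β + γ = 1 := prob_add_prob_compl .of_discrete
  have h0 : κ 0 Set.univ = β := by
    rw [h.measure_univ, blockMeasure_univ ρ Prod.fst b k 0 hb, pow_zero, one_mul]
  have huniv : ∀ j, renewalMeasure (κ 0) (κ (j + 1)) Set.univ =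
      blockMeasure ρ Prod.fst b (k + 1) j Set.univ := by
    intro j
    have := congrArg (fun m => m Set.univ) (h.map_renewalMeasure_fst j)
    simpa only [Measure.map_apply (f := List.map Prod.fst) .of_discrete .univ, Set.preimage_univ]
      using this
  have hwald : ∀ j, γ * ∫⁻ ζ,
        (hammingCount (parse f b k j (ζ.map Prod.fst)) (ζ.map Prod.snd) : ℝ≥0∞)
          ∂renewalMeasure (κ 0) (κ (j + 1)) =
      ∫⁻ ζ, (hammingCount (f (j + 1) (ζ.map Prod.fst)) (ζ.map Prod.snd) : ℝ≥0∞) ∂κ (j + 1) +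
        (∫⁻ ζ, (hammingCount (f 0 (ζ.map Prod.fst)) (ζ.map Prod.snd) : ℝ≥0∞) ∂κ 0) *
          blockMeasure ρ Prod.fst b (k + 1) j Set.univ := by
    intro j
    rw [lintegral_renewalMeasure h0 hβγ hb _
      (fun ζ => (hammingCount (f 0 (ζ.map Prod.fst)) (ζ.map Prod.snd) : ℝ≥0∞)), huniv]
    · congr 1
      refine lintegral_congr_ae ?_
      filter_upwards [h.ae_isMarkerBlock (j + 1)] with ζ hζ
      rw [parse_of_isMarkerBlock hζ]
    · filter_upwards [h.ae_isMarkerBlock 0] with ξ hξ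
      have hae : ∀ᵐ ζ ∂renewalMeasure (κ 0) (κ (j + 1)),
          IsMarkerBlock b (k + 1) j (ζ.map Prod.fst) :=
        ae_renewalMeasure (h.ae_isMarkerBlock 0)
          ((h.ae_isMarkerBlock (j + 1)).mono fun ζ hζ => .lift hζ)
          fun u v hu hv => by rw [List.map_append]; exact .cons hu hv
      filter_upwards [hae] with ζ hζ
      rw [List.map_append, List.map_append, parse_append hξ hζ, hammingCount_append
        (by rw [h.length_eq, List.length_map, List.length_map]), Nat.cast_add]
  rw [← ENNReal.tsum_mul_left]
  simp_rw [hwald]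
  rw [ENNReal.tsum_add, ENNReal.tsum_mul_left, tsum_blockMeasure_univ ρ Prod.fst b _ hb hb',
    mul_one, add_comm, ← tsum_eq_zero_add' (f := fun j => ∫⁻ ζ,
      (hammingCount (f j (ζ.map Prod.fst)) (ζ.map Prod.snd) : ℝ≥0∞) ∂κ j) ENNReal.summable]

theorem ofReal_list_prod {ι : Type*} (p : ι → ℝ) (hp : ∀ a, 0 ≤ p a) (w : List ι) :
    ENNReal.ofReal (w.map p).prod = (w.map fun a => ENNReal.ofReal (p a)).prod := by
  induction w with
  | nil => simp
  | cons a w ih => rw [List.map_cons, List.map_cons, List.prod_cons, List.prod_cons,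
      ENNReal.ofReal_mul (hp a), ih]

/-- The construction step. -/
theorem IsStage.exists_succ (h : IsStage ρ b k κ f) (p q : A → ℝ) (hp : ∀ a, 0 ≤ p a)
    (hq : ∀ a, 0 ≤ q a) (hρp : ∀ a, ρ.map Prod.fst {a} = ENNReal.ofReal (p a))
    (hρq : ∀ a, ρ.map Prod.snd {a} = ENNReal.ofReal (q a)) (η : ℕ → ℝ)
    (hη : ∀ l, ∃ S : Finset (Fin l → A), ∃ θ : ℝ, 0 ≤ θ ∧
        ∑ v, (if v ∈ S then 0 else ∏ i, q (v i)) +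
          ∑ w : Fin l → A, (if θ < ∏ i, p (w i) then ∏ i, p (w i) else 0) + S.card * θ ≤ η l) :
    ∃ κ' f', IsStage ρ b (k + 1) κ' f' ∧
      (∀ j, (∫⁻ ζ, (hammingCount (parse f b k j (ζ.map Prod.fst)) (ζ.map Prod.snd) : ℝ≥0∞)
          ∂κ' j) ≤
        ∫⁻ ζ, (hammingCount (parse f b k j (ζ.map Prod.fst)) (ζ.map Prod.snd) : ℝ≥0∞)
          ∂renewalMeasure (κ 0) (κ (j + 1))) ∧
      ∀ j l, κ' j {ζ | ζ.length = l ∧ ζ.map Prod.snd ≠ f' j (ζ.map Prod.fst)} ≤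
        ENNReal.ofReal (η l) := by
  have hle : ∀ (g : A × A → A) (s : A → ℝ), (∀ a, 0 ≤ s a) →
      (∀ a, ρ.map g {a} = ENNReal.ofReal (s a)) → ∀ j,
      (renewalMeasure (κ 0) (κ (j + 1))).map (List.map g) =
        (blockMeasure ρ Prod.fst b (k + 1) j).map (List.map g) → ∀ w : List A,
      renewalMeasure (κ 0) (κ (j + 1)) {ζ | ζ.map g = w} ≤ ENNReal.ofReal (w.map s).prod := by
    intro g s hs hρs j hmap w
    have e1 : renewalMeasure (κ 0) (κ (j + 1)) {ζ | ζ.map g = w} =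
        (renewalMeasure (κ 0) (κ (j + 1))).map (List.map g) {w} := by
      rw [Measure.map_apply .of_discrete .of_discrete]
      rfl
    rw [e1, hmap, ofReal_list_prod s hs]
    simp only [← hρs]
    rw [← wordMeasure_singleton, ← map_wordMeasure]
    exact Measure.map_mono (blockMeasure_le ρ Prod.fst b (k + 1) j) .of_discrete _
  have key := fun j => exists_word_coupling (renewalMeasure (κ 0) (κ (j + 1))) (⊥ : A) p q hp hq
    η hη (hle _ p hp hρp j (h.map_renewalMeasure_fst j))
    (hle _ q hq hρq j (h.map_renewalMeasure_snd j))
    (fun ζ => hammingCount (parse f b k j (ζ.map Prod.fst)) (ζ.map Prod.snd))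
  choose κ' f' h1 h2 h3 h4 h5 h6 h7 using key
  have hae : ∀ j, ∀ᵐ ζ ∂renewalMeasure (κ 0) (κ (j + 1)), ∀ c ∈ ζ, c.2 ≤ c.1 := fun j =>
    ae_renewalMeasure (h.ae_le 0) (h.ae_le (j + 1)) fun u v hu hv c hc =>
      (List.mem_append.1 hc).elim (hu c) (hv c)
  have hsing : ∀ (m : Measure (List (A × A))) (P : List (A × A) → Prop),
      (∀ᵐ ζ ∂m, P ζ) ↔ ∀ ζ, m {ζ} ≠ 0 → P ζ := by
    intro m P
    exact ae_iff_of_countable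
  refine ⟨κ', f', ⟨?_, ?_, ?_, h5, ?_⟩, h4, h7⟩
  · exact fun j => (h1 j).trans (h.map_renewalMeasure_fst j)
  · exact fun j => (h2 j).trans (h.map_renewalMeasure_snd j)
  · intro j
    rw [hsing]
    exact fun ζ hζ => (hsing _ _).1 (hae j) ζ fun h0 => hζ (h3 j ζ h0)
  · intro j w i
    rcases lt_or_ge i w.length with hi | hi
    · rcases h6 j w with h8 | h8
      · simp [h8, hi]
      · have h9 := (hsing _ _).1 (hae j) _ h8
        have hi' : i < (f' j w).length := by rwa [h5]
        have h10 := h9 (w[i], (f' j w)[i]) (by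
          rw [← List.getElem_zip (h := by simpa using ⟨hi, hi'⟩)]
          exact List.getElem_mem _)
        rwa [List.getD_eq_getElem _ _ hi, List.getD_eq_getElem _ _ hi']
    · rw [List.getD_eq_default _ _ (by rwa [h5])]
      exact bot_le

omit [Fintype A] [DiscreteMeasurableSpace A] in
theorem IsStage.tsum_error_le (h : IsStage ρ b k κ f) (η : ℕ → ℝ)
    (hη : ∀ j l, κ j {ζ | ζ.length = l ∧ ζ.map Prod.snd ≠ f j (ζ.map Prod.fst)} ≤
        ENNReal.ofReal (η l)) :
    ∑' j, (∫⁻ ζ, (if ζ.map Prod.snd = f j (ζ.map Prod.fst) then 0 else ζ.length : ℕ) ∂κ j) ≤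
      ∑' l : ℕ, (l : ℝ≥0∞) ^ 2 * ENNReal.ofReal (η l) := by
  have h1 : ∀ j, (∫⁻ ζ, (if ζ.map Prod.snd = f j (ζ.map Prod.fst) then 0 else ζ.length : ℕ) ∂κ j) ≤
      ∑' l : ℕ, if j < l then (l : ℝ≥0∞) * ENNReal.ofReal (η l) else 0 := by
    intro j
    have h2 : ∀ ζ : List (A × A),
        ((if ζ.map Prod.snd = f j (ζ.map Prod.fst) then 0 else ζ.length : ℕ) : ℝ≥0∞) =
        ∑' l : ℕ, (l : ℝ≥0∞) * Set.indicator
          {ζ | ζ.length = l ∧ ζ.map Prod.snd ≠ f j (ζ.map Prod.fst)} 1 ζ := by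
      intro ζ
      rw [tsum_eq_single ζ.length]
      · rw [Set.indicator_apply]
        simp only [Set.mem_ofPred_eq, true_and]
        split_ifs <;> simp_all
      · intro l hl
        rw [Set.indicator_of_notMem, mul_zero]
        exact fun h3 => hl h3.1.symm
    simp_rw [h2]
    rw [lintegral_tsum fun _ => Measurable.of_discrete.aemeasurable]
    refine ENNReal.tsum_le_tsum fun l => ?_
    rw [lintegral_const_mul _ .of_discrete, lintegral_indicator_one .of_discrete]
    split_ifs with hl
    · gcongr
      exact hη j l
    · rw [nonpos_iff_eq_zero, mul_eq_zero]
      right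
      refine measure_mono_null ?_ (ae_iff.1 (h.ae_isMarkerBlock j))
      rintro ζ ⟨h3, -⟩ h4
      have := h4.lt_length
      rw [List.length_map] at this
      omega
  refine (ENNReal.tsum_le_tsum h1).trans ?_
  rw [ENNReal.tsum_comm]
  refine ENNReal.tsum_le_tsum fun l => ?_
  rw [tsum_eq_sum (s := Finset.range l) (fun j hj => if_neg (by simpa using hj)),
    Finset.sum_congr rfl fun j hj => if_pos (Finset.mem_range.1 hj)]
  simp [sq, mul_assoc]

end Stage

section Tower

variable {A : Type*} [Fintype A] [LinearOrder A] [OrderBot A] [MeasurableSpace A]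
  [DiscreteMeasurableSpace A]

/-- A sequence of consecutive stages with controlled errors. -/
structure IsTower (ρ : Measure (A × A)) (b : A) (K : ℝ≥0∞) (κ : ℕ → ℕ → Measure (List (A × A)))
    (f : ℕ → ℕ → List A → List A) : Prop where
  isStage : ∀ k, IsStage ρ b k (κ k) (f k)
  tsum_error_le : ∀ k, ∑' j, (∫⁻ ζ, (if ζ.map Prod.snd = f (k + 1) j (ζ.map Prod.fst) then 0
    else ζ.length : ℕ) ∂κ (k + 1) j) ≤ K
  tsum_parse_le : ∀ k, cutProb ρ Prod.fst b (k + 1) * ∑' j, ∫⁻ ζ,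
      (hammingCount (parse (f k) b k j (ζ.map Prod.fst)) (ζ.map Prod.snd) : ℝ≥0∞) ∂κ (k + 1) j ≤
    cutProb ρ Prod.fst b k * ∑' j, ∫⁻ ζ,
      (hammingCount (f k j (ζ.map Prod.fst)) (ζ.map Prod.snd) : ℝ≥0∞) ∂κ k j

theorem exists_isTower (ρ : Measure (A × A)) [IsProbabilityMeasure ρ] (b : A)
    (hρ : ∀ᵐ c ∂ρ, c.2 ≤ c.1)
    (hb : ρ (Prod.fst ⁻¹' {b})ᶜ ≠ 0) (hb' : ρ (Prod.fst ⁻¹' {b}) ≠ 0) (p q : A → ℝ)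
    (hp : ∀ a, 0 ≤ p a) (hq : ∀ a, 0 ≤ q a) (hρp : ∀ a, ρ.map Prod.fst {a} = ENNReal.ofReal (p a))
    (hρq : ∀ a, ρ.map Prod.snd {a} = ENNReal.ofReal (q a)) (η : ℕ → ℝ)
    (hη : ∀ l, ∃ S : Finset (Fin l → A), ∃ θ : ℝ, 0 ≤ θ ∧
        ∑ v, (if v ∈ S then 0 else ∏ i, q (v i)) +
          ∑ w : Fin l → A, (if θ < ∏ i, p (w i) then ∏ i, p (w i) else 0) + S.card * θ ≤ η l) :
    ∃ κ f, IsTower ρ b (∑' l : ℕ, (l : ℝ≥0∞) ^ 2 * ENNReal.ofReal (η l)) κ f := by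
  let T (k : ℕ) := {d : (ℕ → Measure (List (A × A))) × (ℕ → List A → List A) //
    IsStage ρ b k d.1 d.2}
  have step : ∀ k (d : T k), ∃ d' : T (k + 1),
      (∀ j, (∫⁻ ζ, (hammingCount (parse d.1.2 b k j (ζ.map Prod.fst)) (ζ.map Prod.snd) : ℝ≥0∞)
          ∂d'.1.1 j) ≤
        ∫⁻ ζ, (hammingCount (parse d.1.2 b k j (ζ.map Prod.fst)) (ζ.map Prod.snd) : ℝ≥0∞)
          ∂renewalMeasure (d.1.1 0) (d.1.1 (j + 1))) ∧
      ∀ j l, d'.1.1 j {ζ | ζ.length = l ∧ ζ.map Prod.snd ≠ d'.1.2 j (ζ.map Prod.fst)} ≤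
        ENNReal.ofReal (η l) := by
    rintro k ⟨⟨κ, f⟩, h⟩
    obtain ⟨κ', f', h', h1, h2⟩ := h.exists_succ p q hp hq hρp hρq η hη
    exact ⟨⟨⟨κ', f'⟩, h'⟩, h1, h2⟩
  choose g hg using step
  let D : ∀ k, T k := fun k => Nat.rec ⟨⟨_, _⟩, isStage_zero hρ⟩ g k
  have hD : ∀ k, D (k + 1) = g k (D k) := fun k => rfl
  refine ⟨fun k => (D k).1.1, fun k => (D k).1.2, fun k => (D k).2, fun k => ?_, fun k => ?_⟩
  · refine (D (k + 1)).2.tsum_error_le η fun j l => ?_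
    rw [hD]
    exact (hg k (D k)).2 j l
  · rw [← (D k).2.mul_tsum_lintegral_parse hb hb', ← mul_assoc]
    have hc : cutProb ρ Prod.fst b (k + 1) =
        cutProb ρ Prod.fst b k * ρ (Prod.fst ⁻¹' {b})ᶜ := by
      rw [cutProb, cutProb, pow_succ]
      ring
    rw [hc]
    refine mul_le_mul' le_rfl (ENNReal.tsum_le_tsum fun j => ?_)
    rw [hD]
    exact (hg k (D k)).1 j

variable {ρ : Measure (A × A)} {b : A} {K : ℝ≥0∞} {κ : ℕ → ℕ → Measure (List (A × A))}
  {f : ℕ → ℕ → List A → List A}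

omit [Fintype A] [DiscreteMeasurableSpace A] in
theorem IsTower.tsum_hammingCount_le (h : IsTower ρ b K κ f) (k : ℕ) :
    ∑' j, ∫⁻ ζ, (hammingCount (f (k + 1) j (ζ.map Prod.fst)) (ζ.map Prod.snd) : ℝ≥0∞)
      ∂κ (k + 1) j ≤ K := by
  refine le_trans ?_ (h.tsum_error_le k)
  gcongr with j ζ
  refine (hammingCount_le _ _).trans (le_of_eq ?_)
  rw [(h.isStage (k + 1)).length_eq, List.length_map]

end Tower

section BlockCode

variable {A : Type*} [Bot A] (f : ℕ → List A → List A) (b : A) (k : ℕ)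

open Classical in
/-- The code which applies `f` to every block of level `k`. -/
noncomputable def blockCode (x : ℤ → A) (p : ℤ) : A :=
  if h : ∃ t : ℕ × ℕ × ℕ, t.1 < t.2.2 ∧ IsBlockAt b k t.2.1 x (p - t.1) t.2.2 then
    (f h.choose.2.1 (window x (p - h.choose.1) h.choose.2.2)).getD h.choose.1 ⊥
  else ⊥

variable {f b k} {x : ℤ → A}

theorem IsBlockAt.blockCode_eq {p : ℤ} {i j l : ℕ} (h : IsBlockAt b k j x (p - i) l)
    (hi : i < l) : blockCode f b k x p = (f j (window x (p - i) l)).getD i ⊥ := by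
  have hex : ∃ t : ℕ × ℕ × ℕ, t.1 < t.2.2 ∧ IsBlockAt b k t.2.1 x (p - t.1) t.2.2 :=
    ⟨(i, j, l), hi, h⟩
  rw [blockCode, dif_pos hex]
  obtain ⟨h1, h2⟩ := hex.choose_spec
  generalize hex.choose = t at h1 h2
  obtain ⟨i', j', l'⟩ := t
  dsimp only at h1 h2 ⊢
  obtain ⟨e1, rfl, rfl⟩ := h.unique (p := p) h2 (by omega) (by omega) (by omega) (by omega)
  obtain rfl : i = i' := by omega
  rfl

theorem IsBlockAt.blockCode_add_eq {s : ℤ} {i j l : ℕ} (h : IsBlockAt b k j x s l)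
    (hi : i < l) : blockCode f b k x (s + i) = (f j (window x s l)).getD i ⊥ := by
  have e : s + i - i = s := by ring
  have h' : IsBlockAt b k j x (s + i - i) l := by rwa [e]
  rw [h'.blockCode_eq hi, e]

theorem blockCode_eq_iff {p : ℤ} {a : A} : blockCode f b k x p = a ↔
    (∃ i j l : ℕ, i < l ∧ IsBlockAt b k j x (p - i) l ∧
      (f j (window x (p - i) l)).getD i ⊥ = a) ∨
    ((¬ ∃ i j l : ℕ, i < l ∧ IsBlockAt b k j x (p - i) l ∧ True) ∧ ⊥ = a) := by
  by_cases hex : ∃ i j l : ℕ, i < l ∧ IsBlockAt b k j x (p - i) l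
  · obtain ⟨i, j, l, hi, h⟩ := hex
    rw [h.blockCode_eq hi]
    constructor
    · exact fun h' => .inl ⟨i, j, l, hi, h, h'⟩
    · rintro (⟨i', j', l', hi', h', he⟩ | ⟨h', -⟩)
      · rwa [← h.blockCode_eq hi, h'.blockCode_eq hi']
      · exact absurd ⟨i, j, l, hi, h, trivial⟩ h'
  · have hex' : ¬ ∃ t : ℕ × ℕ × ℕ, t.1 < t.2.2 ∧ IsBlockAt b k t.2.1 x (p - t.1) t.2.2 :=
      fun ⟨t, ht⟩ => hex ⟨_, _, _, ht⟩
    rw [blockCode, dif_neg hex']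
    constructor
    · exact fun h => .inr ⟨fun ⟨i, j, l, h1, h2, _⟩ => hex ⟨i, j, l, h1, h2⟩, h⟩
    · rintro (⟨i, j, l, h1, h2, _⟩ | ⟨-, h⟩)
      · exact absurd ⟨i, j, l, h1, h2⟩ hex
      · exact h

theorem measurable_blockCode [Countable A] [MeasurableSpace A] [DiscreteMeasurableSpace A] (p : ℤ) :
    Measurable fun x : ℤ → A => blockCode f b k x p := by
  refine measurable_to_countable' fun a => ?_
  have e : (fun x : ℤ → A => blockCode f b k x p) ⁻¹' {a} =
      {x | ∃ i j l : ℕ, i < l ∧ IsBlockAt b k j (id ∘ x) (p - i) l ∧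
        (f j (window x (p - i) l)).getD i ⊥ = a} ∪
      ({x | ∃ i j l : ℕ, i < l ∧ IsBlockAt b k j (id ∘ x) (p - i) l ∧ True}ᶜ ∩ {_x | ⊥ = a}) := by
    ext x
    exact blockCode_eq_iff
  rw [e]
  exact (measurableSet_exists_block id b k p fun i j w => (f j w).getD i ⊥ = a).union
    ((measurableSet_exists_block id b k p fun _ _ _ => True).compl.inter (.const _))

theorem blockCode_shift (x : ℤ → A) (p : ℤ) :
    blockCode f b k (fun i => x (i + 1)) p = blockCode f b k x (p + 1) := by
  have hw : ∀ s l, window (fun i => x (i + 1)) s l = window x (s + 1) l := fun s l =>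
    List.map_congr_left fun i _ => congrArg x (by ring)
  have hB : ∀ j s l, IsBlockAt b k j (fun i => x (i + 1)) s l ↔ IsBlockAt b k j x (s + 1) l := by
    intro j s l
    have e1 : s - 1 + 1 = s + 1 - 1 := by ring
    have e2 : ∀ i : ℕ, s - 1 - i + 1 = s + 1 - 1 - i := fun i => by ring
    simp only [IsBlockAt, IsCut, hw, e1, e2]
  refine blockCode_eq_iff.2 ?_
  have h := (blockCode_eq_iff (f := f) (b := b) (k := k) (x := x) (p := p + 1)).1 rfl
  have e : ∀ i : ℕ, p - i + 1 = p + 1 - i := fun i => by ring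
  simpa only [hw, hB, e] using h

theorem blockCode_le {A : Type*} [PartialOrder A] [OrderBot A] {f : ℕ → List A → List A} {b : A}
    {k : ℕ} (hf : ∀ j w i, (f j w).getD i ⊥ ≤ w.getD i ⊥) (x : ℤ → A) (p : ℤ) :
    blockCode f b k x p ≤ x p := by
  rcases blockCode_eq_iff.1 (Eq.refl (blockCode f b k x p)) with ⟨i, j, l, hi, -, h⟩ | ⟨-, h⟩
  · rw [← h]
    refine (hf _ _ _).trans (le_of_eq ?_)
    rw [List.getD_eq_getElem _ _ (by simpa using hi)]
    simp [window]
  · rw [← h]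
    exact bot_le

theorem IsMarkerBlock.blockCode_eq_parse (hf : ∀ j w, (f j w).length = w.length) {s : ℤ}
    {i j : ℕ} {w : List A} (h : IsMarkerBlock b (k + 1) j w) (hs : IsCut b k x s)
    (hw : window x s w.length = w) (hi : i < w.length) :
    blockCode f b k x (s + i) = (parse f b k j w).getD i ⊥ := by
  generalize hK : k + 1 = K at h
  induction h generalizing s i with
  | base => omega
  | @lift _ j w hw' =>
    cases hK
    have hB : IsBlockAt b k (j + 1) x s w.length := ⟨hs, by rwa [hw]⟩
    rw [hB.blockCode_add_eq hi, hw, parse_of_isMarkerBlock hw']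
  | @cons _ j u w hu hw' ih1 ih2 =>
    cases hK
    obtain ⟨h1, h2⟩ := window_append.1 hw
    have hB : IsBlockAt b k 0 x s u.length := ⟨hs, by rwa [h1]⟩
    rw [parse_append hu hw']
    rcases lt_or_ge i u.length with hi' | hi'
    · rw [hB.blockCode_add_eq hi', h1, List.getD_append _ _ _ _ (by rwa [hf])]
    · obtain ⟨n, rfl⟩ := Nat.exists_eq_add_of_le hi'
      have e : s + (u.length + n : ℕ) = s + u.length + n := by push_cast; ring
      rw [e, List.getD_append_right _ _ _ _ (by rwa [hf]), hf, Nat.add_sub_cancel_left]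
      exact ih2 (hu.isCut hs.1 h1).1 h2 (by simpa using hi) rfl

theorem IsBlockAt.blockCode_eq_parse (hf : ∀ j w, (f j w).length = w.length) {s : ℤ} {i j l : ℕ}
    (h : IsBlockAt b (k + 1) j x s l) (hi : i < l) :
    blockCode f b k x (s + i) = (parse f b k j (window x s l)).getD i ⊥ :=
  h.2.blockCode_eq_parse hf (h.1.mono k.le_succ) (by rw [length_window]) (by rwa [length_window])

section LimitCode

variable (F : ℕ → ℕ → List A → List A) (b : A)

open Classical in
/-- The eventual value of the codes of level `k`, for large `k`. -/
noncomputable def limitCode (x : ℤ → A) (p : ℤ) : A :=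
  if h : ∃ a, ∀ᶠ k in Filter.atTop, blockCode (F k) b k x p = a then h.choose else ⊥

variable {F b}

theorem limitCode_eq {x : ℤ → A} {p : ℤ} {a : A}
    (h : ∀ᶠ k in Filter.atTop, blockCode (F k) b k x p = a) : limitCode F b x p = a := by
  have hex : ∃ a, ∀ᶠ k in Filter.atTop, blockCode (F k) b k x p = a := ⟨a, h⟩
  rw [limitCode, dif_pos hex]
  obtain ⟨k, h1, h2⟩ := (h.and hex.choose_spec).exists
  exact h2.symm.trans h1

theorem limitCode_eq_iff {x : ℤ → A} {p : ℤ} {a : A} : limitCode F b x p = a ↔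
    (∀ᶠ k in Filter.atTop, blockCode (F k) b k x p = a) ∨
      ((¬ ∃ a, ∀ᶠ k in Filter.atTop, blockCode (F k) b k x p = a) ∧ ⊥ = a) := by
  by_cases hex : ∃ a, ∀ᶠ k in Filter.atTop, blockCode (F k) b k x p = a
  · obtain ⟨a', h⟩ := hex
    rw [limitCode_eq h]
    constructor
    · rintro rfl
      exact .inl h
    · rintro (h' | ⟨h', -⟩)
      · rw [← limitCode_eq h, limitCode_eq h']
      · exact absurd ⟨a', h⟩ h'
  · rw [limitCode, dif_neg hex]
    constructor
    · exact fun h => .inr ⟨hex, h⟩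
    · rintro (h | ⟨-, h⟩)
      · exact absurd ⟨a, h⟩ hex
      · exact h

theorem limitCode_shift (x : ℤ → A) (p : ℤ) :
    limitCode F b (fun i => x (i + 1)) p = limitCode F b x (p + 1) := by
  refine limitCode_eq_iff.2 ?_
  simpa only [blockCode_shift] using
    limitCode_eq_iff.1 (Eq.refl (limitCode F b x (p + 1)))

theorem limitCode_le {A : Type*} [PartialOrder A] [OrderBot A] {F : ℕ → ℕ → List A → List A} {b : A}
    (hF : ∀ k j w i, (F k j w).getD i ⊥ ≤ w.getD i ⊥) (x : ℤ → A) (p : ℤ) :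
    limitCode F b x p ≤ x p := by
  rcases limitCode_eq_iff.1 (Eq.refl (limitCode F b x p)) with h | ⟨-, h⟩
  · obtain ⟨k, hk⟩ := h.exists
    rw [← hk]
    exact blockCode_le (hF k) x p
  · rw [← h]
    exact bot_le

theorem measurable_limitCode [Countable A] [MeasurableSpace A] [DiscreteMeasurableSpace A] :
    Measurable (limitCode F b) := by
  refine measurable_pi_lambda _ fun p => measurable_to_countable' fun a => ?_
  have hev : ∀ a, MeasurableSet {x | ∀ᶠ k in Filter.atTop, blockCode (F k) b k x p = a} := by
    intro a
    have e : {x | ∀ᶠ k in Filter.atTop, blockCode (F k) b k x p = a} =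
        ⋃ n : ℕ, ⋂ k : ℕ, ⋂ _ : n ≤ k, (fun x => blockCode (F k) b k x p) ⁻¹' {a} := by
      ext x
      simp [Filter.eventually_atTop]
    rw [e]
    exact .iUnion fun n => .iInter fun k => .iInter fun _ =>
      measurable_blockCode p (measurableSet_singleton a)
  have e : (fun x => limitCode F b x p) ⁻¹' {a} =
      {x | ∀ᶠ k in Filter.atTop, blockCode (F k) b k x p = a} ∪
      ((⋃ a, {x | ∀ᶠ k in Filter.atTop, blockCode (F k) b k x p = a})ᶜ ∩ {_x | ⊥ = a}) := by
    ext x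
    refine limitCode_eq_iff.trans ?_
    simp
  rw [e]
  exact (hev a).union ((MeasurableSet.iUnion hev).compl.inter (.const _))

end LimitCode

end BlockCode

section Limit

theorem ext_of_window_le {B : Type*} [MeasurableSpace B] [DiscreteMeasurableSpace B] [Countable B]
    {μ ν : Measure (ℤ → B)} [IsProbabilityMeasure μ] [IsProbabilityMeasure ν]
    (h : ∀ (s : ℤ) (ζ : List B),
      μ {z | window z s ζ.length = ζ} ≤ ν {z | window z s ζ.length = ζ}) : μ = ν := by
  refine ext_of_window fun s ζ => ?_
  have hw := measurable_window (B := B) s ζ.length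
  have := Measure.isProbabilityMeasure_map (μ := μ) hw.aemeasurable
  have := Measure.isProbabilityMeasure_map (μ := ν) hw.aemeasurable
  have key : μ.map (fun z => window z s ζ.length) = ν.map (fun z => window z s ζ.length) := by
    refine Measure.eq_of_le_of_isProbabilityMeasure (Measure.le_iff.2 fun W _ => ?_)
    rw [← Measure.sum_smul_dirac (μ.map fun z => window z s ζ.length),
      ← Measure.sum_smul_dirac (ν.map fun z => window z s ζ.length),
      Measure.sum_apply _ .of_discrete, Measure.sum_apply _ .of_discrete]
    refine ENNReal.tsum_le_tsum fun w => ?_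
    rw [Measure.smul_apply, Measure.smul_apply]
    refine mul_le_mul' ?_ le_rfl
    rw [Measure.map_apply hw .of_discrete, Measure.map_apply hw .of_discrete]
    by_cases hl : w.length = ζ.length
    · have := h s w
      rwa [hl] at this
    · have h2 : (fun z : ℤ → B => window z s ζ.length) ⁻¹' {w} = ∅ := by
        ext z
        simp only [Set.mem_preimage, Set.mem_singleton_iff, Set.mem_empty_iff_false, iff_false]
        rintro rfl
        simp at hl
      rw [h2, measure_empty]
      exact zero_le
  have := DFunLike.congr_fun key {ζ}
  rwa [Measure.map_apply hw .of_discrete, Measure.map_apply hw .of_discrete] at this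

variable {A : Type*} [Fintype A] [LinearOrder A] [OrderBot A] [MeasurableSpace A]
  [DiscreteMeasurableSpace A] {ρ : Measure (A × A)} [IsProbabilityMeasure ρ] {b : A} {K : ℝ≥0∞}
  {κ : ℕ → ℕ → Measure (List (A × A))} {f : ℕ → ℕ → List A → List A}
  {ν : Measure (ℤ → A × A)} [IsProbabilityMeasure ν]

omit [OrderBot A] in
theorem tsum_cutProb_ne_top (hb' : ρ (Prod.fst ⁻¹' {b}) ≠ 0) :
    ∑' k, cutProb ρ Prod.fst b k ≠ ∞ := by
  simp only [cutProb]
  rw [ENNReal.tsum_mul_right, ENNReal.tsum_geometric]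
  refine ENNReal.mul_ne_top ?_ (measure_ne_top _ _)
  rw [← prob_compl_eq_one_sub .of_discrete, compl_compl]
  exact ENNReal.inv_ne_top.2 hb'

theorem IsTower.measure_blockCode_ne_le (h : IsTower ρ b K κ f) (hν : HasWindowLaw ν ρ)
    (hb : ρ (Prod.fst ⁻¹' {b})ᶜ ≠ 0) (hb' : ρ (Prod.fst ⁻¹' {b}) ≠ 0) (p : ℤ) (k : ℕ) :
    ν {z | blockCode (f (k + 1)) b (k + 1) (Prod.fst ∘ z) p ≠
        blockCode (f (k + 2)) b (k + 2) (Prod.fst ∘ z) p} ≤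
      cutProb ρ Prod.fst b (k + 1) * K + cutProb ρ Prod.fst b (k + 2) * K := by
  classical
  set c := cutProb ρ Prod.fst b with hc
  let G : ℕ → ℕ → List (A × A) → Prop := fun i j ζ =>
    (parse (f (k + 1)) b (k + 1) j (ζ.map Prod.fst)).getD i ⊥ ≠
      (f (k + 2) j (ζ.map Prod.fst)).getD i ⊥
  have hlen := (h.isStage (k + 1)).length_eq
  calc _ ≤ ν {z | ∃ i j l : ℕ, i < l ∧ IsBlockAt b (k + 2) j (Prod.fst ∘ z) (p - i) l ∧
        G i j (window z (p - i) l)} := by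
        refine measure_mono_ae ?_
        filter_upwards [hν.ae_exists_block Prod.fst b (k + 2) hb hb' p] with z hz hne
        obtain ⟨i, j, l, hi, hB⟩ := hz
        refine ⟨i, j, l, hi, hB, ?_⟩
        have e1 := hB.blockCode_eq_parse (f := f (k + 1)) hlen hi
        have e : p - i + i = p := by ring
        rw [e] at e1
        simp only [G]
        rw [map_window, ← e1, ← hB.blockCode_eq hi]
        exact hne
    _ = c (k + 2) * ∑' j, ∫⁻ ζ, (hammingCount (parse (f (k + 1)) b (k + 1) j (ζ.map Prod.fst))
          (f (k + 2) j (ζ.map Prod.fst)) : ℝ≥0∞) ∂blockMeasure ρ Prod.fst b (k + 2) j := by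
        rw [hν.measure_exists_block Prod.fst b (k + 2) hb p G]
        congr! 6 with j ζ
        rw [hammingCount, length_parse hlen, List.length_map]
        push_cast
        refine Finset.sum_congr rfl fun i _ => ?_
        simp [G]
    _ = c (k + 2) * ∑' j, ∫⁻ ζ, (hammingCount (parse (f (k + 1)) b (k + 1) j (ζ.map Prod.fst))
          (f (k + 2) j (ζ.map Prod.fst)) : ℝ≥0∞) ∂κ (k + 2) j := by
        congr 2
        funext j
        exact ((h.isStage (k + 2)).lintegral_fst j fun w =>
          (hammingCount (parse (f (k + 1)) b (k + 1) j w) (f (k + 2) j w) : ℝ≥0∞)).symm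
    _ ≤ c (k + 2) * ∑' j, ∫⁻ ζ, ((hammingCount (parse (f (k + 1)) b (k + 1) j (ζ.map Prod.fst))
          (ζ.map Prod.snd) : ℝ≥0∞) + (if ζ.map Prod.snd = f (k + 2) j (ζ.map Prod.fst) then 0
            else ζ.length : ℕ)) ∂κ (k + 2) j := by
        gcongr with j ζ
        norm_cast
        refine (hammingCount_triangle (v := ζ.map Prod.snd) ?_).trans
          (add_le_add le_rfl ((hammingCount_le _ _).trans (le_of_eq ?_)))
        · rw [length_parse hlen, List.length_map, List.length_map]
        · rw [List.length_map]
          simp only [eq_comm]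
    _ = c (k + 2) * ∑' j, (∫⁻ ζ, (hammingCount (parse (f (k + 1)) b (k + 1) j (ζ.map Prod.fst))
          (ζ.map Prod.snd) : ℝ≥0∞) ∂κ (k + 2) j) + c (k + 2) * ∑' j, (∫⁻ ζ,
          (if ζ.map Prod.snd = f (k + 2) j (ζ.map Prod.fst) then 0 else ζ.length : ℕ)
            ∂κ (k + 2) j) := by
        rw [← mul_add, ← ENNReal.tsum_add]
        congr 2
        funext j
        exact lintegral_add_left .of_discrete _
    _ ≤ _ := by
        exact add_le_add
          ((h.tsum_parse_le (k + 1)).trans (mul_le_mul' le_rfl (h.tsum_hammingCount_le k)))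
          (mul_le_mul' le_rfl (h.tsum_error_le (k + 1)))

theorem IsTower.ae_eventually_blockCode_eq (h : IsTower ρ b K κ f) (hK : K ≠ ∞)
    (hν : HasWindowLaw ν ρ)
    (hb : ρ (Prod.fst ⁻¹' {b})ᶜ ≠ 0) (hb' : ρ (Prod.fst ⁻¹' {b}) ≠ 0) :
    ∀ᵐ z ∂ν, ∀ p, ∀ᶠ k in Filter.atTop,
      blockCode (f k) b k (Prod.fst ∘ z) p = limitCode f b (Prod.fst ∘ z) p := by
  refine ae_all_iff.2 fun p => ?_
  have hsum : ∑' k, ν {z | blockCode (f (k + 1)) b (k + 1) (Prod.fst ∘ z) p ≠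
      blockCode (f (k + 2)) b (k + 2) (Prod.fst ∘ z) p} ≠ ∞ := by
    refine ne_top_of_le_ne_top ?_
      (ENNReal.tsum_le_tsum fun k => h.measure_blockCode_ne_le hν hb hb' p k)
    rw [ENNReal.tsum_add, ENNReal.tsum_mul_right, ENNReal.tsum_mul_right]
    have hc := tsum_cutProb_ne_top hb'
    refine ENNReal.add_ne_top.2 ⟨ENNReal.mul_ne_top ?_ hK, ENNReal.mul_ne_top ?_ hK⟩
    · exact ne_top_of_le_ne_top hc
        (ENNReal.tsum_comp_le_tsum_of_injective (add_left_injective 1) _)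
    · exact ne_top_of_le_ne_top hc
        (ENNReal.tsum_comp_le_tsum_of_injective (add_left_injective 2) _)
  filter_upwards [ae_eventually_notMem hsum] with z hz
  simp only [not_not] at hz
  obtain ⟨n, hn⟩ := Filter.eventually_atTop.1 hz
  have hconst : ∀ k, blockCode (f (n + 1 + k)) b (n + 1 + k) (Prod.fst ∘ z) p =
      blockCode (f (n + 1)) b (n + 1) (Prod.fst ∘ z) p := by
    intro k
    induction k with
    | zero => rfl
    | succ k ih =>
      rw [← ih]
      have := hn (n + k) (by omega)
      rw [show n + 1 + (k + 1) = n + k + 2 by ring, show n + 1 + k = n + k + 1 by ring]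
      exact this.symm
  have hev : ∀ᶠ k in Filter.atTop, blockCode (f k) b k (Prod.fst ∘ z) p =
      blockCode (f (n + 1)) b (n + 1) (Prod.fst ∘ z) p := by
    refine Filter.eventually_atTop.2 ⟨n + 1, fun k hk => ?_⟩
    obtain ⟨m, rfl⟩ := Nat.exists_eq_add_of_le hk
    exact hconst m
  rw [limitCode_eq hev]
  exact hev

open Classical in
theorem IsTower.measure_window_snd_le (h : IsTower ρ b K κ f) (hν : HasWindowLaw ν ρ)
    (hb : ρ (Prod.fst ⁻¹' {b})ᶜ ≠ 0) (hb' : ρ (Prod.fst ⁻¹' {b}) ≠ 0) (s : ℤ) (u : List A)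
    (k : ℕ) :
    ν {z | window (Prod.snd ∘ z) s u.length = u} ≤
      ν {z | window (blockCode (f (k + 1)) b (k + 1) (Prod.fst ∘ z)) s u.length = u} +
        cutProb ρ Prod.fst b (k + 1) * (K + u.length) := by
  set c := cutProb ρ Prod.fst b (k + 1) with hc
  let m := u.length
  let Q : List A → ℕ → Prop := fun w i => i + m ≤ w.length ∧ (w.drop i).take m = u
  let cnt : List A → ℕ := fun w => ∑ i ∈ Finset.range w.length, if Q w i then 1 else 0
  let E : (ℕ → ℕ → List (A × A) → Prop) → Set (ℤ → A × A) := fun G =>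
    {z | ∃ i j l : ℕ, i < l ∧ IsBlockAt b (k + 1) j (Prod.fst ∘ z) (s - i) l ∧
      G i j (window z (s - i) l)}
  have hE : ∀ G, ν (E G) = c * ∑' j, ∫⁻ ζ, (∑ i ∈ Finset.range ζ.length, if G i j ζ then 1 else 0)
      ∂blockMeasure ρ Prod.fst b (k + 1) j :=
    fun G => hν.measure_exists_block Prod.fst b (k + 1) hb s G
  have hstage := h.isStage (k + 1)
  have hwin : ∀ (x : ℤ → A) (i l : ℕ), i + m ≤ l →
      ((window x (s - i) l).drop i).take m = window x s m := by
    intro x i l hl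
    obtain ⟨n, rfl⟩ := Nat.exists_eq_add_of_le hl
    have e : s - i + i = s := by ring
    rw [add_assoc, window_add, window_add, List.drop_left' (by simp), List.take_left' (by simp), e]
  have hE1 : ν {z | window (Prod.snd ∘ z) s m = u} ≤
      ν (E fun i _ ζ => Q (ζ.map Prod.snd) i) + ν (E fun i _ ζ => ζ.length < i + m) := by
    refine (measure_mono_ae ?_).trans (measure_union_le _ _)
    filter_upwards [hν.ae_exists_block Prod.fst b (k + 1) hb hb' s] with z hz hu
    obtain ⟨i, j, l, hi, hB⟩ := hz
    rcases le_or_gt (i + m) l with hl | hl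
    · refine .inl ⟨i, j, l, hi, hB, by simpa using hl, ?_⟩
      rw [map_window, hwin _ _ _ hl]
      exact hu
    · exact .inr ⟨i, j, l, hi, hB, by simpa using hl⟩
  have hE3 : ν (E fun i j ζ => Q (f (k + 1) j (ζ.map Prod.fst)) i) ≤
      ν {z | window (blockCode (f (k + 1)) b (k + 1) (Prod.fst ∘ z)) s m = u} := by
    refine measure_mono ?_
    rintro z ⟨i, j, l, hi, hB, hl, hQ⟩
    rw [hstage.length_eq, List.length_map, length_window] at hl
    have hw : window (blockCode (f (k + 1)) b (k + 1) (Prod.fst ∘ z)) (s - i) l =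
        f (k + 1) j (window (Prod.fst ∘ z) (s - i) l) := by
      have hlen : (f (k + 1) j (window (Prod.fst ∘ z) (s - i) l)).length = l := by
        rw [hstage.length_eq, length_window]
      conv_lhs => rw [← hlen]
      refine window_eq_iff.2 fun n hn => ?_
      rw [hB.blockCode_add_eq (by rwa [hlen] at hn), List.getD_eq_getElem _ _ hn]
    rw [map_window, ← hw, hwin _ _ _ hl] at hQ
    exact hQ
  have hbad : ν (E fun i _ ζ => ζ.length < i + m) ≤ c * m := by
    refine (hE fun i _ ζ => ζ.length < i + m).le.trans (mul_le_mul' le_rfl ?_)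
    calc _ ≤ ∑' j, ∫⁻ ζ, (m : ℝ≥0∞) ∂blockMeasure ρ Prod.fst b (k + 1) j := by
          gcongr with j ζ
          rw [← Nat.cast_one, ← Nat.cast_zero]
          simp only [← Nat.cast_ite]
          rw [← Nat.cast_sum]
          norm_cast
          calc _ ≤ ∑ i ∈ Finset.range ζ.length,
                if i ∈ Finset.Ico (ζ.length - m) ζ.length then 1 else 0 := by
                refine Finset.sum_le_sum fun i hi => ?_
                rw [Finset.mem_range] at hi
                split_ifs with h1 h2
                · exact le_rfl
                · exact absurd (Finset.mem_Ico.2 ⟨by omega, hi⟩) h2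
                · exact zero_le_one
                · exact le_rfl
            _ ≤ (Finset.Ico (ζ.length - m) ζ.length).card := by
                rw [Finset.sum_ite_mem, Finset.sum_const, smul_eq_mul, mul_one]
                exact Finset.card_le_card Finset.inter_subset_right
            _ ≤ m := by
                rw [Nat.card_Ico]
                omega
      _ = m := by
          simp only [lintegral_const]
          rw [ENNReal.tsum_mul_left, tsum_blockMeasure_univ ρ Prod.fst b (k + 1) hb hb', mul_one]
  have hcount : ν (E fun i _ ζ => Q (ζ.map Prod.snd) i) ≤
      ν (E fun i j ζ => Q (f (k + 1) j (ζ.map Prod.fst)) i) + c * K := by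
    calc _ = c * ∑' j, ∫⁻ ζ, (cnt (ζ.map Prod.snd) : ℝ≥0∞)
          ∂blockMeasure ρ Prod.fst b (k + 1) j := by
          refine (hE fun i _ ζ => Q (ζ.map Prod.snd) i).trans ?_
          congr! 6 with j ζ
          simp only [cnt, List.length_map]
          push_cast
          exact Finset.sum_congr rfl fun i _ => by congr
      _ = c * ∑' j, ∫⁻ ζ, (cnt (ζ.map Prod.snd) : ℝ≥0∞) ∂κ (k + 1) j := by
          congr 2
          funext j
          exact (hstage.lintegral_snd j fun w => (cnt w : ℝ≥0∞)).symm
      _ ≤ c * ∑' j, ∫⁻ ζ, ((cnt (f (k + 1) j (ζ.map Prod.fst)) : ℝ≥0∞) +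
          (if ζ.map Prod.snd = f (k + 1) j (ζ.map Prod.fst) then 0 else ζ.length : ℕ))
            ∂κ (k + 1) j := by
          gcongr with j ζ
          norm_cast
          split_ifs with he
          · rw [he]
            simp
          · refine le_trans ?_ (Nat.le_add_left _ _)
            refine (Finset.sum_le_card_nsmul _ _ 1 fun i _ => by split_ifs <;> simp).trans ?_
            simp
      _ = c * ∑' j, (∫⁻ ζ, (cnt (f (k + 1) j (ζ.map Prod.fst)) : ℝ≥0∞) ∂κ (k + 1) j) +
          c * ∑' j, (∫⁻ ζ, (if ζ.map Prod.snd = f (k + 1) j (ζ.map Prod.fst) then 0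
            else ζ.length : ℕ) ∂κ (k + 1) j) := by
          rw [← mul_add, ← ENNReal.tsum_add]
          congr 2
          funext j
          exact lintegral_add_left .of_discrete _
      _ ≤ c * ∑' j, (∫⁻ ζ, (cnt (f (k + 1) j (ζ.map Prod.fst)) : ℝ≥0∞)
            ∂blockMeasure ρ Prod.fst b (k + 1) j) + c * K := by
          refine add_le_add (le_of_eq ?_) (mul_le_mul' le_rfl (h.tsum_error_le k))
          congr 2
          funext j
          exact hstage.lintegral_fst j fun w => (cnt (f (k + 1) j w) : ℝ≥0∞)
      _ = _ := by
          congr 1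
          refine Eq.trans ?_ (hE fun i j ζ => Q (f (k + 1) j (ζ.map Prod.fst)) i).symm
          congr! 6 with j ζ
          simp only [cnt, hstage.length_eq, List.length_map]
          push_cast
          exact Finset.sum_congr rfl fun i _ => by congr
  calc _ ≤ _ := hE1
    _ ≤ ν {z | window (blockCode (f (k + 1)) b (k + 1) (Prod.fst ∘ z)) s m = u} + c * K + c * m :=
        add_le_add (hcount.trans (add_le_add hE3 le_rfl)) hbad
    _ = _ := by rw [add_assoc, mul_add]

theorem IsTower.map_limitCode (h : IsTower ρ b K κ f) (hK : K ≠ ∞) (hν : HasWindowLaw ν ρ)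
    (hb : ρ (Prod.fst ⁻¹' {b})ᶜ ≠ 0) (hb' : ρ (Prod.fst ⁻¹' {b}) ≠ 0) :
    (ν.map fun z => Prod.fst ∘ z).map (limitCode f b) = ν.map fun z => Prod.snd ∘ z := by
  have hfst : Measurable fun z : ℤ → A × A => Prod.fst ∘ z :=
    measurable_pi_iff.2 fun i => Measurable.of_discrete.comp (measurable_pi_apply i)
  have hsnd : Measurable fun z : ℤ → A × A => Prod.snd ∘ z :=
    measurable_pi_iff.2 fun i => Measurable.of_discrete.comp (measurable_pi_apply i)
  have hlim : Measurable (limitCode f b) := measurable_limitCode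
  rw [Measure.map_map hlim hfst]
  have := Measure.isProbabilityMeasure_map (μ := ν) hsnd.aemeasurable
  have := Measure.isProbabilityMeasure_map (μ := ν) (hlim.comp hfst).aemeasurable
  refine (ext_of_window_le fun s u => ?_).symm
  have hmeas : MeasurableSet {y : ℤ → A | window y s u.length = u} :=
    measurable_window s _ (MeasurableSet.of_discrete (s := {u}))
  rw [Measure.map_apply hsnd hmeas, Measure.map_apply (hlim.comp hfst) hmeas]
  have hbc : ∀ k, Measurable fun z : ℤ → A × A =>
      blockCode (f (k + 1)) b (k + 1) (Prod.fst ∘ z) := fun k =>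
    measurable_pi_lambda _ fun p => (measurable_blockCode p).comp hfst
  have h1 : Filter.Tendsto (fun k => ν
      {z | window (blockCode (f (k + 1)) b (k + 1) (Prod.fst ∘ z)) s u.length = u}) Filter.atTop
      (nhds (ν (limitCode f b ∘ (fun z => Prod.fst ∘ z) ⁻¹' {y | window y s u.length = u}))) := by
    refine tendsto_measure_of_ae_tendsto_indicator_of_isFiniteMeasure Filter.atTop
      ((hlim.comp hfst) hmeas) (fun k => hbc k hmeas) ?_
    filter_upwards [h.ae_eventually_blockCode_eq hK hν hb hb'] with z hz
    have hz' : ∀ᶠ k in Filter.atTop, ∀ i ∈ Finset.range u.length,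
        blockCode (f (k + 1)) b (k + 1) (Prod.fst ∘ z) (s + (i : ℕ)) =
          limitCode f b (Prod.fst ∘ z) (s + (i : ℕ)) :=
      (Filter.eventually_all_finset _).2 fun i _ =>
        (Filter.tendsto_add_atTop_nat 1).eventually (hz _)
    filter_upwards [hz'] with k hk
    have : window (blockCode (f (k + 1)) b (k + 1) (Prod.fst ∘ z)) s u.length =
        window (limitCode f b (Prod.fst ∘ z)) s u.length :=
      List.map_congr_left fun i hi => hk i (by simpa using hi)
    simp only [Set.mem_ofPred_eq, Set.mem_preimage, Function.comp_def] at this ⊢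
    rw [this]
  have h2 : Filter.Tendsto (fun k => cutProb ρ Prod.fst b (k + 1) * (K + u.length)) Filter.atTop
      (nhds (0 * (K + u.length))) := by
    refine ENNReal.Tendsto.mul_const ?_ (.inr (by simp [hK]))
    exact (Filter.tendsto_add_atTop_iff_nat 1).2
      (ENNReal.tendsto_atTop_zero_of_tsum_ne_top (tsum_cutProb_ne_top hb'))
  have h3 := h1.add h2
  rw [zero_mul, add_zero] at h3
  exact ge_of_tendsto' h3 fun k => h.measure_window_snd_le hν hb hb' s u k

end Limit

section Sinai

variable {N : ℕ} {p q : Fin N → ℝ}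

/-- A stochastic domination is witnessed by a coupling. -/
theorem exists_monotone_coupling_measure (hp0 : ∀ i, 0 ≤ p i) (hp1 : ∑ i, p i = 1)
    (hq0 : ∀ i, 0 ≤ q i) (hq1 : ∑ i, q i = 1)
    (hdom : ∀ k : Fin N, ∑ i ∈ Finset.Iic k, p i ≤ ∑ i ∈ Finset.Iic k, q i) :
    ∃ ρ : Measure (Fin N × Fin N), IsProbabilityMeasure ρ ∧
      (∀ a, ρ.map Prod.fst {a} = ENNReal.ofReal (p a)) ∧
      (∀ a, ρ.map Prod.snd {a} = ENNReal.ofReal (q a)) ∧ ∀ᵐ c ∂ρ, c.2 ≤ c.1 := by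
  obtain ⟨r, hr0, hrp, hrq, hr⟩ := exists_monotone_coupling p q hp0 hp1 hq0 hq1 hdom
  let ρ : Measure (Fin N × Fin N) :=
    Measure.sum fun c => ENNReal.ofReal (r c.1 c.2) • Measure.dirac c
  have hρ : ∀ c, ρ {c} = ENNReal.ofReal (r c.1 c.2) := fun c => by
    simp only [ρ, Measure.sum_smul_dirac_singleton]
  have hfst : ∀ a, ρ.map Prod.fst {a} = ENNReal.ofReal (p a) := by
    intro a
    rw [Measure.map_apply .of_discrete .of_discrete, ← hrp a,
      ENNReal.ofReal_sum_of_nonneg fun y _ => hr0 a y]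
    have e : Prod.fst ⁻¹' {a} = ⋃ y : Fin N, {(a, y)} := by
      ext ⟨x, y⟩
      simp [eq_comm]
    rw [e, measure_iUnion (fun y y' hy => by simpa using hy) fun _ => .of_discrete, tsum_fintype]
    simp only [hρ]
  have hsnd : ∀ a, ρ.map Prod.snd {a} = ENNReal.ofReal (q a) := by
    intro a
    rw [Measure.map_apply .of_discrete .of_discrete, ← hrq a,
      ENNReal.ofReal_sum_of_nonneg fun x _ => hr0 x a]
    have e : Prod.snd ⁻¹' {a} = ⋃ x : Fin N, {(x, a)} := by
      ext ⟨x, y⟩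
      simp [eq_comm]
    rw [e, measure_iUnion (fun y y' hy => by simpa using hy) fun _ => .of_discrete, tsum_fintype]
    simp only [hρ]
  refine ⟨ρ, ⟨?_⟩, hfst, hsnd, ae_iff_of_countable.2 fun c hc => hr _ _ fun h0 => hc ?_⟩
  · have h1 : ρ.map Prod.fst Set.univ = ∑ a, ENNReal.ofReal (p a) := by
      rw [← Finset.coe_univ, ← sum_measure_singleton]
      simp only [hfst]
    rw [Measure.map_apply .of_discrete .univ, Set.preimage_univ,
      ← ENNReal.ofReal_sum_of_nonneg fun a _ => hp0 a, hp1, ENNReal.ofReal_one] at h1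
    exact h1
  · rw [hρ, h0, ENNReal.ofReal_zero]

theorem IsBernoulli.hasWindowLaw {μ : Measure (ℤ → Fin N)} (hμ : IsBernoulli p μ)
    {m : Measure (Fin N)} (hm : ∀ a, m {a} = ENNReal.ofReal (p a)) : HasWindowLaw μ m := by
  have := hμ.1
  refine hasWindowLaw_of_cylinder fun s f => ?_
  simp only [hm]
  exact hμ.2 s f

theorem HasWindowLaw.eq {B : Type*} [MeasurableSpace B] [DiscreteMeasurableSpace B] [Countable B]
    {μ ν : Measure (ℤ → B)} [IsProbabilityMeasure μ] [IsProbabilityMeasure ν] {m : Measure B}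
    (hμ : HasWindowLaw μ m) (hν : HasWindowLaw ν m) : μ = ν :=
  ext_of_window fun s ζ => (hμ s ζ).trans (hν s ζ).symm

end Sinai

/-- A monotone Sinai theorem: if `H(p) > H(q)` and `p` stochastically dominates `q`,
then the Bernoulli shift `B(q)` is a monotone factor of `B(p)`. -/
theorem monotone_sinai {N : ℕ} (hN : 1 ≤ N) (p q : Fin N → ℝ)
    (hp0 : ∀ i, 0 ≤ p i) (hp1 : ∑ i, p i = 1)
    (hq0 : ∀ i, 0 ≤ q i) (hq1 : ∑ i, q i = 1)
    (hH : shannonH p > shannonH q)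
    (hdom : ∀ k : Fin N, ∑ i ∈ Finset.Iic k, p i ≤ ∑ i ∈ Finset.Iic k, q i)
    (μ ν : Measure (ℤ → Fin N)) (hμ : IsBernoulli p μ) (hν : IsBernoulli q ν) :
    ∃ φ : (ℤ → Fin N) → (ℤ → Fin N),
      Measurable φ ∧ μ.map φ = ν ∧
      (∀ᵐ x ∂μ, φ (shiftMap x) = shiftMap (φ x)) ∧
      (∀ᵐ x ∂μ, ∀ i : ℤ, φ x i ≤ x i) := by
  have : NeZero N := ⟨by omega⟩
  have := hμ.1
  have := hν.1
  obtain ⟨ρ, hρ1, hρp, hρq, hρ⟩ := exists_monotone_coupling_measure hp0 hp1 hq0 hq1 hdom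
  obtain ⟨η, hη0, hηs, hη⟩ := exists_entropy_gap_rate p q hp0 hp1 hq0 hq1 hH
  obtain ⟨b, hb0, hb1⟩ := exists_mem_Ioo_of_entropy_pos p hp0 hp1
    ((entropy_nonneg q hq0 hq1).trans_lt hH)
  have hβ : ρ (Prod.fst ⁻¹' {b}) = ENNReal.ofReal (p b) := by
    rw [← hρp, Measure.map_apply .of_discrete .of_discrete]
  have hb' : ρ (Prod.fst ⁻¹' {b}) ≠ 0 := by simpa [hβ] using hb0
  have hb : ρ (Prod.fst ⁻¹' {b})ᶜ ≠ 0 := by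
    rw [prob_compl_eq_one_sub .of_discrete, hβ]
    simpa [tsub_eq_zero_iff_le] using hb1
  obtain ⟨κ, f, h⟩ := exists_isTower ρ b hρ hb hb' p q hp0 hq0 hρp hρq η hη
  have hK : ∑' l : ℕ, (l : ℝ≥0∞) ^ 2 * ENNReal.ofReal (η l) ≠ ∞ := by
    have e : ∀ l : ℕ, (l : ℝ≥0∞) ^ 2 * ENNReal.ofReal (η l) =
        ENNReal.ofReal ((l : ℝ) ^ 2 * η l) := fun l => by
      rw [ENNReal.ofReal_mul (by positivity), ENNReal.ofReal_pow (by positivity),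
        ENNReal.ofReal_natCast]
    simp only [e]
    exact hηs.tsum_ofReal_ne_top
  obtain ⟨m, hm, hmρ⟩ := exists_hasWindowLaw ρ
  have hμm : (m.map fun z => Prod.fst ∘ z) = μ := by
    have hmeas : Measurable fun z : ℤ → Fin N × Fin N => Prod.fst ∘ z :=
      measurable_pi_iff.2 fun i => Measurable.of_discrete.comp (measurable_pi_apply i)
    have := Measure.isProbabilityMeasure_map (μ := m) hmeas.aemeasurable
    exact (hmρ.map Prod.fst).eq (hμ.hasWindowLaw hρp)
  have hνm : (m.map fun z => Prod.snd ∘ z) = ν := by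
    have hmeas : Measurable fun z : ℤ → Fin N × Fin N => Prod.snd ∘ z :=
      measurable_pi_iff.2 fun i => Measurable.of_discrete.comp (measurable_pi_apply i)
    have := Measure.isProbabilityMeasure_map (μ := m) hmeas.aemeasurable
    exact (hmρ.map Prod.snd).eq (hν.hasWindowLaw hρq)
  refine ⟨limitCode f b, measurable_limitCode, ?_, .of_forall fun x => ?_, .of_forall fun x => ?_⟩
  · rw [← hμm, ← hνm]
    exact h.map_limitCode hK hmρ hb hb'
  · exact funext fun i => limitCode_shift x i
  · exact limitCode_le (fun k => (h.isStage k).getD_le) x
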